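/- arXiv:2002.08644 — 2 statements merged into one kernel-verified Lean document; each statement's English description precedes it below -/
import Mathlib

section
/- A bounded domain Ω ⊆ ℂ has property S if and only if its boundary ∂Ω is a Peano compactum. -/
open Set Metric Filter MeasureTheory Topology

noncomputable section

/-- A planar domain: a nonempty open connected subset of ℂ. -/
def IsPlanarDomain (D : Set ℂ) : Prop := D.Nonempty ∧ IsOpen D ∧ IsConnected D

/-- A Peano compactum: a compact subset of ℂ all of whose connected components are
locally connected (as subspaces of ℂ) and such that for every `C > 0` only finitely
many components have diameter greater than `C`. -/
def IsPeanoCompactum (K : Set ℂ) : Prop :=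
  IsCompact K ∧
  (∀ x ∈ K, LocallyConnectedSpace ↥(connectedComponentIn K x)) ∧
  ∀ C : ℝ, 0 < C →
    {Q : Set ℂ | (∃ x ∈ K, Q = connectedComponentIn K x) ∧ C < Metric.diam Q}.Finite

/-- A Jordan curve: a subset of ℂ homeomorphic to the unit circle. -/
def IsJordanCurve (J : Set ℂ) : Prop :=
  Nonempty (↥J ≃ₜ ↥(Metric.sphere (0:ℂ) 1))

/-- A generalized Jordan domain: a bounded domain whose boundary is a Peano compactum,
each of whose boundary components is a single point or a Jordan curve. -/
def IsGeneralizedJordanDomain (D : Set ℂ) : Prop :=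
  IsPlanarDomain D ∧ Bornology.IsBounded D ∧
  IsPeanoCompactum (frontier D) ∧
  ∀ x ∈ frontier D,
    connectedComponentIn (frontier D) x = {x} ∨
    IsJordanCurve (connectedComponentIn (frontier D) x)

/-- `φ` restricts to a homeomorphism of `D` onto `Ω`. -/
def IsHomeoOnto (φ : ℂ → ℂ) (D Ω : Set ℂ) : Prop :=
  ContinuousOn φ D ∧ Set.BijOn φ D Ω ∧
  ∃ ψ : ℂ → ℂ, ContinuousOn ψ Ω ∧ Set.InvOn ψ φ D Ω

/-- `φ` is a conformal homeomorphism (holomorphic bijection) of `D` onto `Ω`. -/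
def IsConformalHomeoOnto (φ : ℂ → ℂ) (D Ω : Set ℂ) : Prop :=
  DifferentiableOn ℂ φ D ∧ Set.BijOn φ D Ω

/-- `φb` is a continuous extension of `φ : D → Ω` to `closure D`, with values in `closure Ω`. -/
def ExtendsContinuously (φ φb : ℂ → ℂ) (D Ω : Set ℂ) : Prop :=
  ContinuousOn φb (closure D) ∧ Set.EqOn φb φ D ∧ Set.MapsTo φb (closure D) (closure Ω)

/-- The oscDiam `σ_r(z₀) = diam φ(D ∩ C_r(z₀))`. -/
def oscDiam (φ : ℂ → ℂ) (D : Set ℂ) (z₀ : ℂ) (r : ℝ) : ℝ :=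
  Metric.diam (φ '' (D ∩ Metric.sphere z₀ r))

/-- `liminf_{r→0⁺} σ_r(z₀) = 0`. -/
def OscLiminfZero (φ : ℂ → ℂ) (D : Set ℂ) (z₀ : ℂ) : Prop :=
  Filter.liminf (oscDiam φ D z₀) (nhdsWithin (0:ℝ) (Set.Ioi 0)) = 0

/-- A circle domain (normalized so that ∞ lies in a complementary disk): every bounded
complementary component is a point or a closed round disk, and the unbounded
complementary component is the complement of an open round disk. -/
def IsCircleDomain (D : Set ℂ) : Prop :=
  IsPlanarDomain D ∧ Bornology.IsBounded D ∧
  ∀ x ∈ Dᶜ,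
    (Bornology.IsBounded (connectedComponentIn Dᶜ x) →
      connectedComponentIn Dᶜ x = {x} ∨
      ∃ c : ℂ, ∃ rad : ℝ, 0 < rad ∧ connectedComponentIn Dᶜ x = Metric.closedBall c rad) ∧
    (¬ Bornology.IsBounded (connectedComponentIn Dᶜ x) →
      ∃ c : ℂ, ∃ rad : ℝ, 0 < rad ∧ connectedComponentIn Dᶜ x = (Metric.ball c rad)ᶜ)

/-- A set has σ-finite linear (1-dimensional Hausdorff) measure. -/
def SigmaFiniteH1 (E : Set ℂ) : Prop :=
  ∃ f : ℕ → Set ℂ, (⋃ n, f n) = E ∧ ∀ n, μH[1] (f n) < ⊤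

/-- The set of connected components of `K` containing more than one point. -/
def NondegComponents (K : Set ℂ) : Set (Set ℂ) :=
  {Q | (∃ x ∈ K, Q = connectedComponentIn K x) ∧ ∃ a ∈ Q, ∃ b ∈ Q, a ≠ b}

/-- The union of the singleton connected components of `K`. -/
def SingletonPart (K : Set ℂ) : Set ℂ :=
  {x | x ∈ K ∧ connectedComponentIn K x = {x}}

/-- The cluster set `C(h, z₀) = ⋂_{r>0} closure h({z ∈ U : |z − z₀| < r})`. -/
def clusterSet (h : ℂ → ℂ) (U : Set ℂ) (z₀ : ℂ) : Set ℂ :=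
  ⋂ r ∈ Set.Ioi (0:ℝ), closure (h '' (U ∩ Metric.ball z₀ r))

/-- The boundary component of `Ω` corresponding (under `φ : D → Ω`) to a boundary
component `Q` of `D`: `φ^B(Q) = ⋃_{z ∈ Q} C(φ, z)`. -/
def boundaryComp (φ : ℂ → ℂ) (D : Set ℂ) (Q : Set ℂ) : Set ℂ :=
  ⋃ z ∈ Q, clusterSet φ D z

/-- An arc: the image of a continuous injective map from `[0,1]`. -/
def IsArc (A : Set ℂ) : Prop :=
  ∃ f : ℝ → ℂ, ContinuousOn f (Set.Icc 0 1) ∧ Set.InjOn f (Set.Icc 0 1) ∧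
    f '' Set.Icc 0 1 = A

/-- An arc from `a` to `b`. -/
def IsArcFromTo (A : Set ℂ) (a b : ℂ) : Prop :=
  ∃ f : ℝ → ℂ, ContinuousOn f (Set.Icc 0 1) ∧ Set.InjOn f (Set.Icc 0 1) ∧
    f '' Set.Icc 0 1 = A ∧ f 0 = a ∧ f 1 = b

/-- Property S: for every `ε > 0`, `Ω` is a finite union of connected sets of diameter `< ε`. -/
def PropertyS (Ω : Set ℂ) : Prop :=
  ∀ ε > (0:ℝ), ∃ (k : ℕ) (N : Fin k → Set ℂ),
    (∀ i, IsConnected (N i) ∧ Metric.diam (N i) < ε) ∧ (⋃ i, N i) = Ω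

/-- `x ∈ ∂Ω` is locally accessible from `Ω`. -/
def LocallyAccessible (Ω : Set ℂ) (x : ℂ) : Prop :=
  ∀ ε > (0:ℝ), ∃ δ > (0:ℝ), ∀ z ∈ Ω, dist z x < δ →
    ∃ A : Set ℂ, IsArcFromTo A z x ∧ A ⊆ Ω ∪ {x} ∧ Metric.diam A < ε

/-- `ξ ∈ ∂Ω` is locally sequentially accessible. -/
def LocallySeqAccessible (Ω : Set ℂ) (ξ : ℂ) : Prop :=
  ∀ r > (0:ℝ), ∀ ξn : ℕ → ℂ, (∀ n, ξn n ∈ Ω) → Filter.Tendsto ξn Filter.atTop (nhds ξ) →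
    ∃ x ∈ Ω ∩ Metric.ball ξ r,
      {n : ℕ | ξn n ∈ connectedComponentIn (Ω ∩ Metric.ball ξ r) x}.Infinite

/-- `Ω` is finitely connected at the boundary point `x`. -/
def FinitelyConnectedAt (Ω : Set ℂ) (x : ℂ) : Prop :=
  ∀ r > (0:ℝ), ∃ U : Set ℂ, IsOpen U ∧ x ∈ U ∧ U ⊆ Metric.ball x r ∧
    {Q : Set ℂ | ∃ y ∈ U ∩ Ω, Q = connectedComponentIn (U ∩ Ω) y}.Finite

/-- The diameter (Mazurkiewicz) distance on `Ω`. -/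
def mazDist (Ω : Set ℂ) (x y : ℂ) : ℝ :=
  sInf (Metric.diam '' {E : Set ℂ | E ⊆ Ω ∧ IsConnected E ∧ x ∈ E ∧ y ∈ E})

/-- `Ω` is totally bounded for the Mazurkiewicz distance; for a metric space this is
equivalent to compactness of the metric completion of `(Ω, mazDist)`. -/
def MazCompletionCompact (Ω : Set ℂ) : Prop :=
  ∀ ε > (0:ℝ), ∃ F : Finset ℂ, ↑F ⊆ Ω ∧ ∀ x ∈ Ω, ∃ y ∈ F, mazDist Ω x y < ε

/-- `f : A → B` is non-alternating: there are no `x, y ∈ B` and no separation of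
`A \ f⁻¹({x})` into two disjoint nonempty relatively open sets `A₁, A₂` with
`y ∈ f(A₁) ∩ f(A₂)`. -/
def NonAlternatingOn (f : ℂ → ℂ) (A B : Set ℂ) : Prop :=
  ¬ ∃ x ∈ B, ∃ y ∈ B, ∃ A₁ A₂ : Set ℂ,
      A₁.Nonempty ∧ A₂.Nonempty ∧ Disjoint A₁ A₂ ∧
      A₁ ∪ A₂ = {z | z ∈ A ∧ f z ≠ x} ∧
      (∃ U₁ : Set ℂ, IsOpen U₁ ∧ A₁ = U₁ ∩ {z | z ∈ A ∧ f z ≠ x}) ∧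
      (∃ U₂ : Set ℂ, IsOpen U₂ ∧ A₂ = U₂ ∩ {z | z ∈ A ∧ f z ≠ x}) ∧
      y ∈ f '' A₁ ∧ y ∈ f '' A₂

section Components

variable {α : Type*} [TopologicalSpace α]

theorem IsClosed.isClosed_connectedComponentIn {X : Set α} (hX : IsClosed X) (x : α) :
    IsClosed (connectedComponentIn X x) := by
  by_cases hx : x ∈ X
  · refine isClosed_of_closure_subset ?_
    exact isPreconnected_connectedComponentIn.closure.subset_connectedComponentIn
      (subset_closure (mem_connectedComponentIn hx))
      (closure_minimal (connectedComponentIn_subset X x) hX)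
  · rw [connectedComponentIn_eq_empty hx]
    exact isClosed_empty

theorem subset_connectedComponentIn_of_mem {X V : Set α} {x y : α}
    (hV : IsPreconnected V) (hVX : V ⊆ X) (hy : y ∈ V) (hyx : y ∈ connectedComponentIn X x) :
    V ⊆ connectedComponentIn X x := by
  rw [connectedComponentIn_eq hyx]
  exact hV.subset_connectedComponentIn hy hVX

theorem closure_connectedComponentIn_inter_subset (Y : Set α) (x : α) :
    closure (connectedComponentIn Y x) ∩ Y ⊆ connectedComponentIn Y x := by
  rintro y ⟨hy, hyY⟩
  by_cases hx : x ∈ Y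
  · have h : IsPreconnected (insert y (connectedComponentIn Y x)) :=
      isPreconnected_connectedComponentIn.subset_closure (subset_insert _ _)
        (insert_subset hy subset_closure)
    exact h.subset_connectedComponentIn (mem_insert_of_mem _ (mem_connectedComponentIn hx))
      (insert_subset hyY (connectedComponentIn_subset Y x)) (mem_insert _ _)
  · rw [connectedComponentIn_eq_empty hx] at hy
    simp at hy

variable [T2Space α]

/-- In a compact set, closed sets `A` and `B` such that no component meets both of them are
separated by a relatively clopen set. -/
theorem IsCompact.exists_isClosed_separation {X A B : Set α} (hX : IsCompact X)
    (hA : IsClosed A) (hB : IsClosed B) (hAX : A ⊆ X)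
    (h : ∀ a ∈ A, Disjoint (connectedComponentIn X a) B) :
    ∃ V ⊆ X, IsClosed V ∧ IsClosed (X \ V) ∧ A ⊆ V ∧ Disjoint V B := by
  have hAc : IsCompact A := hX.of_isClosed_subset hA hAX
  refine hAc.induction_on (p := fun s ↦ ∃ V ⊆ X, IsClosed V ∧ IsClosed (X \ V) ∧ s ⊆ V ∧
    Disjoint V B) ?_ ?_ ?_ ?_
  · exact ⟨∅, empty_subset _, isClosed_empty, by simpa using hX.isClosed, Subset.rfl,
      empty_disjoint _⟩
  · rintro s t hst ⟨V, h1, h2, h3, h4, h5⟩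
    exact ⟨V, h1, h2, h3, hst.trans h4, h5⟩
  · rintro s t ⟨V, h1, h2, h3, h4, h5⟩ ⟨W, g1, g2, g3, g4, g5⟩
    refine ⟨V ∪ W, union_subset h1 g1, h2.union g2, ?_, union_subset_union h4 g4,
      h5.union_left g5⟩
    rw [← sdiff_inter_sdiff]
    exact h3.inter g3
  · intro a ha
    have : CompactSpace X := isCompact_iff_compactSpace.1 hX
    have hB' : IsClosed ((↑) ⁻¹' B : Set X) := hB.preimage continuous_subtype_val
    let π : X → ConnectedComponents X := (↑)
    have hπ : Continuous π := ConnectedComponents.continuous_coe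
    have hU : IsOpen (π '' ((↑) ⁻¹' B))ᶜ := (hB'.isCompact.image hπ).isClosed.isOpen_compl
    have haU : π ⟨a, hAX ha⟩ ∈ (π '' ((↑) ⁻¹' B))ᶜ := by
      rintro ⟨b, hbB, hb⟩
      have hb' : b ∈ connectedComponent (⟨a, hAX ha⟩ : X) :=
        ConnectedComponents.coe_eq_coe'.1 hb
      have : (b : α) ∈ connectedComponentIn X a := by
        rw [connectedComponentIn_eq_image (hAX ha)]
        exact mem_image_of_mem _ hb'
      exact (h a ha).le_bot ⟨this, hbB⟩
    obtain ⟨V, hV, haV, hVU⟩ := compact_exists_isClopen_in_isOpen hU haU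
    have hW : IsClopen (π ⁻¹' V) := hV.preimage hπ
    have himg : ∀ s : Set X, IsClosed s → IsClosed ((↑) '' s : Set α) := fun s hs ↦
      hX.isClosed.isClosedMap_subtype_val _ hs
    have hcompl : X \ ((↑) '' (π ⁻¹' V) : Set α) = (↑) '' (π ⁻¹' V)ᶜ := by
      ext z
      constructor
      · rintro ⟨hz, hzV⟩
        exact ⟨⟨z, hz⟩, fun hz' ↦ hzV ⟨⟨z, hz⟩, hz', rfl⟩, rfl⟩
      · rintro ⟨z, hz, rfl⟩
        refine ⟨z.2, ?_⟩
        rintro ⟨w, hw, hwz⟩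
        exact hz (Subtype.ext hwz ▸ hw)
    have hcl : IsClosed (X \ ((↑) '' (π ⁻¹' V) : Set α)) := hcompl ▸ himg _ hW.compl.1
    refine ⟨(↑) '' (π ⁻¹' V), ?_, (↑) '' (π ⁻¹' V), ?_, himg _ hW.1, hcl, Subset.rfl, ?_⟩
    · refine mem_nhdsWithin.2 ⟨(X \ ((↑) '' (π ⁻¹' V) : Set α))ᶜ, hcl.isOpen_compl, ?_, ?_⟩
      · exact fun hn ↦ hn.2 ⟨⟨a, hAX ha⟩, haV, rfl⟩
      · rintro z ⟨hz, hzA⟩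
        by_contra hcon
        exact hz ⟨hAX hzA, hcon⟩
    · rintro _ ⟨z, -, rfl⟩
      exact z.2
    · rw [disjoint_left]
      rintro _ ⟨z, hz, rfl⟩ hzB
      exact hVU hz ⟨z, hzB, rfl⟩

theorem IsCompact.isClosed_setOf_connectedComponentIn_inter_nonempty {X F : Set α}
    (hX : IsCompact X) (hF : IsClosed F) :
    IsClosed {z | z ∈ X ∧ (connectedComponentIn X z ∩ F).Nonempty} := by
  refine isClosed_of_closure_subset fun z hz ↦ ?_
  have hzX : z ∈ X := closure_minimal (fun w hw ↦ hw.1) hX.isClosed hz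
  refine ⟨hzX, ?_⟩
  by_contra hcon
  obtain ⟨V, -, hV, hXV, hzV, hVF⟩ := hX.exists_isClosed_separation
    (isClosed_singleton (x := z)) hF (singleton_subset_iff.2 hzX) (by
      rintro a rfl
      rwa [disjoint_iff_inter_eq_empty, ← not_nonempty_iff_eq_empty])
  have hsub : {z | z ∈ X ∧ (connectedComponentIn X z ∩ F).Nonempty} ⊆ X \ V := by
    rintro w ⟨hwX, x, hxw, hxF⟩
    refine ⟨hwX, fun hwV ↦ ?_⟩
    have hpre := isPreconnected_connectedComponentIn (x := w) (F := X)
    obtain ⟨y, -, hyV, hyX⟩ := isPreconnected_closed_iff.1 hpre V (X \ V) hV hXV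
      (fun y hy ↦ by
        by_cases hyV : y ∈ V
        · exact Or.inl hyV
        · exact Or.inr ⟨connectedComponentIn_subset _ _ hy, hyV⟩)
      ⟨w, mem_connectedComponentIn hwX, hwV⟩
      ⟨x, hxw, connectedComponentIn_subset _ _ hxw, fun hxV ↦ hVF.le_bot ⟨hxV, hxF⟩⟩
    exact hyX.2 hyV
  exact (closure_minimal hsub hXV hz).2 (hzV rfl)

/-- Boundary bumping: components of a sublevel set of a continuum reach the boundary level. -/
theorem exists_mem_connectedComponentIn_le {D : Set α} {u : α → ℝ} {y : α} {b : ℝ}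
    (hD : IsPreconnected D) (hDc : IsCompact D) (hu : Continuous u) (hy : y ∈ D) (hyb : u y ≤ b)
    (hq : ∃ q ∈ D, b ≤ u q) : ∃ w ∈ connectedComponentIn (D ∩ {z | u z ≤ b}) y, u w = b := by
  by_contra hcon
  have hle : IsClosed {z | u z ≤ b} := isClosed_le hu continuous_const
  obtain ⟨V, hVX, hV, hXV, hyV, hVB⟩ := (hDc.inter_right hle).exists_isClosed_separation
    (isClosed_singleton (x := y)) (isClosed_eq hu (continuous_const (y := b)))
    (singleton_subset_iff.2 ⟨hy, hyb⟩) (by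
      rintro a rfl
      rw [disjoint_left]
      exact fun w hw hwb ↦ hcon ⟨w, hw, hwb⟩)
  obtain ⟨q, hqD, hqb⟩ := hq
  obtain ⟨w, -, hwV, hw⟩ := isPreconnected_closed_iff.1 hD V
    (((D ∩ {z | u z ≤ b}) \ V) ∪ (D ∩ {z | b ≤ u z})) hV
    (hXV.union (hDc.isClosed.inter (isClosed_le continuous_const hu)))
    (fun z hz ↦ by
      by_cases hzV : z ∈ V
      · exact Or.inl hzV
      · rcases le_total (u z) b with h | h
        · exact Or.inr (Or.inl ⟨⟨hz, h⟩, hzV⟩)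
        · exact Or.inr (Or.inr ⟨hz, h⟩))
    ⟨y, hy, hyV rfl⟩ ⟨q, hqD, Or.inr ⟨hqD, hqb⟩⟩
  rcases hw with hw | hw
  · exact hw.2 hwV
  · exact hVB.le_bot ⟨hwV, le_antisymm (hVX hwV).2 hw.2⟩

theorem exists_mem_connectedComponentIn_ge {D : Set α} {u : α → ℝ} {y : α} {a : ℝ}
    (hD : IsPreconnected D) (hDc : IsCompact D) (hu : Continuous u) (hy : y ∈ D) (hya : a ≤ u y)
    (hq : ∃ q ∈ D, u q ≤ a) : ∃ w ∈ connectedComponentIn (D ∩ {z | a ≤ u z}) y, u w = a := by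
  obtain ⟨q, hqD, hqa⟩ := hq
  obtain ⟨w, hw, hwa⟩ := exists_mem_connectedComponentIn_le hD hDc hu.neg hy (neg_le_neg hya)
    ⟨q, hqD, neg_le_neg hqa⟩
  refine ⟨w, ?_, neg_injective hwa⟩
  simpa only [Pi.neg_apply, neg_le_neg_iff] using hw

/-- A continuum meeting both sides of a slab contains a continuum crossing that slab. -/
theorem exists_crossing_subset {D : Set α} {u : α → ℝ} {a b : ℝ} {p q : α}
    (hD : IsPreconnected D) (hDc : IsCompact D) (hu : Continuous u) (hab : a ≤ b)
    (hp : p ∈ D) (hpa : u p ≤ a) (hq : q ∈ D) (hqb : b ≤ u q) :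
    ∃ R ⊆ D, IsCompact R ∧ IsPreconnected R ∧ (∀ z ∈ R, a ≤ u z ∧ u z ≤ b) ∧
      (∃ l ∈ R, u l = a) ∧ ∃ r ∈ R, u r = b := by
  obtain ⟨w, hw, hwb⟩ := exists_mem_connectedComponentIn_le hD hDc hu hp (hpa.trans hab)
    ⟨q, hq, hqb⟩
  set D₁ := connectedComponentIn (D ∩ {z | u z ≤ b}) p
  have hle : IsClosed {z | u z ≤ b} := isClosed_le hu continuous_const
  have hge : IsClosed {z | a ≤ u z} := isClosed_le continuous_const hu
  have hD₁s : D₁ ⊆ D ∩ {z | u z ≤ b} := connectedComponentIn_subset _ _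
  have hD₁c : IsCompact D₁ := hDc.of_isClosed_subset
    ((hDc.isClosed.inter hle).isClosed_connectedComponentIn p) (hD₁s.trans inter_subset_left)
  have hpD₁ : p ∈ D₁ := mem_connectedComponentIn ⟨hp, hpa.trans hab⟩
  have hwa : a ≤ u w := hwb ▸ hab
  obtain ⟨v, hv, hva⟩ := exists_mem_connectedComponentIn_ge
    isPreconnected_connectedComponentIn hD₁c hu hw hwa ⟨p, hpD₁, hpa⟩
  have hRs := connectedComponentIn_subset (D₁ ∩ {z | a ≤ u z}) w
  refine ⟨connectedComponentIn (D₁ ∩ {z | a ≤ u z}) w,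
    hRs.trans (inter_subset_left.trans (hD₁s.trans inter_subset_left)),
    hD₁c.of_isClosed_subset ((hD₁c.isClosed.inter hge).isClosed_connectedComponentIn w)
      (hRs.trans inter_subset_left),
    isPreconnected_connectedComponentIn,
    fun z hz ↦ ⟨(hRs hz).2, (hD₁s (hRs hz).1).2⟩, ⟨v, hv, hva⟩,
    ⟨w, mem_connectedComponentIn ⟨hw, hwa⟩, hwb⟩⟩

end Components

section ContinuousLogarithms

variable {α : Type*} [TopologicalSpace α]

/-- `f` has a continuous logarithm on `X`. -/
def HasContLog (f : α → ℂ) (X : Set α) : Prop :=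
  ∃ g : α → ℂ, ContinuousOn g X ∧ ∀ z ∈ X, Complex.exp (g z) = f z

namespace HasContLog

variable {f f' : α → ℂ} {X Y : Set α}

theorem mono (h : HasContLog f X) (hY : Y ⊆ X) : HasContLog f Y :=
  let ⟨g, hg, hgf⟩ := h
  ⟨g, hg.mono hY, fun z hz ↦ hgf z (hY hz)⟩

theorem congr (h : HasContLog f X) (hff : EqOn f f' X) : HasContLog f' X :=
  let ⟨g, hg, hgf⟩ := h
  ⟨g, hg, fun z hz ↦ (hgf z hz).trans (hff hz)⟩

theorem const {c : ℂ} (hc : c ≠ 0) (X : Set α) : HasContLog (fun _ ↦ c) X :=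
  ⟨fun _ ↦ Complex.log c, continuousOn_const, fun _ _ ↦ Complex.exp_log hc⟩

theorem mul (h : HasContLog f X) (h' : HasContLog f' X) : HasContLog (fun z ↦ f z * f' z) X :=
  let ⟨g, hg, hgf⟩ := h
  let ⟨g', hg', hgf'⟩ := h'
  ⟨fun z ↦ g z + g' z, hg.add hg', fun z hz ↦ by rw [Complex.exp_add, hgf z hz, hgf' z hz]⟩

theorem zpow (h : HasContLog f X) (n : ℤ) : HasContLog (fun z ↦ f z ^ n) X :=
  let ⟨g, hg, hgf⟩ := h
  ⟨fun z ↦ n * g z, continuousOn_const.mul hg, fun z hz ↦ by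
    rw [Complex.exp_int_mul, hgf z hz]⟩

theorem div (h : HasContLog f X) (h' : HasContLog f' X) : HasContLog (fun z ↦ f z / f' z) X :=
  (h.mul (h'.zpow (-1))).congr fun z _ ↦ by simp [div_eq_mul_inv]

theorem prod {ι : Type*} {f : ι → α → ℂ} (s : Finset ι) (h : ∀ i ∈ s, HasContLog (f i) X) :
    HasContLog (fun z ↦ ∏ i ∈ s, f i z) X := by
  classical
  induction s using Finset.induction_on with
  | empty => simpa using const one_ne_zero X
  | insert i s hi ih =>
    simp only [Finset.prod_insert hi]
    exact (h i (Finset.mem_insert_self i s)).mul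
      (ih fun j hj ↦ h j (Finset.mem_insert_of_mem hj))

theorem of_norm_sub_one_lt (hf : ContinuousOn f X) (h : ∀ z ∈ X, ‖f z - 1‖ < 1) :
    HasContLog f X := by
  have hs : ∀ z ∈ X, f z ∈ Complex.slitPlane := fun z hz ↦ by
    simpa using Complex.mem_slitPlane_of_norm_lt_one (h z hz)
  exact ⟨fun z ↦ Complex.log (f z), hf.clog hs,
    fun z hz ↦ Complex.exp_log (Complex.slitPlane_ne_zero (hs z hz))⟩

theorem union_of_eqOn {g g' : α → ℂ} (hX : IsClosed X) (hY : IsClosed Y)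
    (hg : ContinuousOn g X) (hg' : ContinuousOn g' Y) (hgf : ∀ z ∈ X, Complex.exp (g z) = f z)
    (hgf' : ∀ z ∈ Y, Complex.exp (g' z) = f z) (hgg : EqOn g g' (X ∩ Y)) :
    HasContLog f (X ∪ Y) := by
  classical
  have h1 : EqOn (X.piecewise g g') g X := piecewise_eqOn X g g'
  have h2 : EqOn (X.piecewise g g') g' Y := fun z hz ↦ by
    by_cases hzX : z ∈ X
    · rw [piecewise_eq_of_mem _ _ _ hzX, hgg ⟨hzX, hz⟩]
    · rw [piecewise_eq_of_notMem _ _ _ hzX]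
  refine ⟨X.piecewise g g', (hg.congr h1).union_of_isClosed (hg'.congr h2) hX hY, ?_⟩
  rintro z (hz | hz)
  · rw [h1 hz, hgf z hz]
  · rw [h2 hz, hgf' z hz]

theorem union_of_disjoint (hX : IsClosed X) (hY : IsClosed Y) (hd : Disjoint X Y)
    (h : HasContLog f X) (h' : HasContLog f Y) : HasContLog f (X ∪ Y) :=
  let ⟨_, hg, hgf⟩ := h
  let ⟨_, hg', hgf'⟩ := h'
  union_of_eqOn hX hY hg hg' hgf hgf' (by rw [hd.inter_eq]; exact eqOn_empty _ _)

/-- Homotopy invariance: along a connected parameter set, the members of a continuous family of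
nonvanishing functions differ by exponentials. -/
theorem div_of_isPreconnected {T : Type*} [TopologicalSpace T] {E : Set T} {F : T → α → ℂ}
    (hE : IsPreconnected E) (hX : IsCompact X)
    (hF : ContinuousOn (fun w : T × α ↦ F w.1 w.2) (E ×ˢ X))
    (h0 : ∀ t ∈ E, ∀ z ∈ X, F t z ≠ 0) {p q : T} (hp : p ∈ E) (hq : q ∈ E) :
    HasContLog (fun z ↦ F p z / F q z) X := by
  have hFt : ∀ t ∈ E, ContinuousOn (F t) X := fun t ht ↦
    hF.comp (f := fun z ↦ (t, z)) (by fun_prop) fun z hz ↦ ⟨ht, hz⟩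
  refine hE.induction₂ (fun p q ↦ HasContLog (fun z ↦ F p z / F q z) X) ?_ ?_ ?_ hp hq
  · intro t ht
    have key : ∀ᶠ s in 𝓝 t, ∀ z ∈ X, s ∈ E → z ∈ X → ‖F t z / F s z - 1‖ < 1 := by
      refine hX.eventually_forall_of_forall_eventually
        (P := fun s z ↦ s ∈ E → z ∈ X → ‖F t z / F s z - 1‖ < 1) fun z hz ↦ ?_
      have hc : ContinuousWithinAt (fun w : T × α ↦ ‖F t w.2 / F w.1 w.2 - 1‖) (E ×ˢ X) (t, z) := by
        have h1 : ContinuousWithinAt (fun w : T × α ↦ F t w.2) (E ×ˢ X) (t, z) :=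
          ((hFt t ht).comp continuous_snd.continuousOn fun w hw ↦ hw.2) (t, z) ⟨ht, hz⟩
        exact ((h1.div (hF (t, z) ⟨ht, hz⟩) (h0 t ht z hz)).sub continuousWithinAt_const).norm
      have hlt : ‖F t z / F t z - 1‖ < 1 := by simp [div_self (h0 t ht z hz)]
      filter_upwards [eventually_nhdsWithin_iff.1 (hc.eventually_lt continuousWithinAt_const hlt)]
        with w hw h1 h2 using hw ⟨h1, h2⟩
    filter_upwards [nhdsWithin_le_nhds key, self_mem_nhdsWithin] with s hs hsE
    exact of_norm_sub_one_lt ((hFt t ht).div (hFt s hsE) (h0 s hsE)) fun z hz ↦ hs z hz hsE hz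
  · intro p q r _ hq _ hpq hqr
    exact (hpq.mul hqr).congr fun z hz ↦ div_mul_div_cancel₀ (h0 q hq z hz)
  · intro p q _ _ hpq
    exact (hpq.zpow (-1)).congr fun z _ ↦ by simp

end HasContLog

theorem IsPreconnected.sub_eq_sub_of_exp_eq {R : Set α} {g h : α → ℂ} (hR : IsPreconnected R)
    (hg : ContinuousOn g R) (hh : ContinuousOn h R)
    (hgh : ∀ z ∈ R, Complex.exp (g z) = Complex.exp (h z)) {x y : α} (hx : x ∈ R) (hy : y ∈ R) :
    g x - h x = g y - h y := by
  refine hR.induction₂ (fun x y ↦ g x - h x = g y - h y) ?_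
    (fun _ _ _ _ _ _ h1 h2 ↦ h1.trans h2) (fun _ _ _ _ h1 ↦ h1.symm) hx hy
  intro x hx
  have hc : ContinuousWithinAt (fun y ↦ ‖(g y - h y) - (g x - h x)‖) R x :=
    ((((hg x hx).sub (hh x hx))).sub continuousWithinAt_const).norm
  have hlt : ‖(g x - h x) - (g x - h x)‖ < Real.pi := by simpa using Real.pi_pos
  filter_upwards [hc.eventually_lt continuousWithinAt_const hlt, self_mem_nhdsWithin] with y hy hyR
  have him := abs_lt.1 ((Complex.abs_im_le_norm _).trans_lt hy)
  have hexp : Complex.exp ((g y - h y) - (g x - h x)) = 1 := by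
    rw [Complex.exp_sub, Complex.exp_sub, Complex.exp_sub, hgh y hyR, hgh x hx]
    simp [Complex.exp_ne_zero]
  have := Complex.log_exp him.1 him.2.le
  rw [hexp, Complex.log_one] at this
  exact (sub_eq_zero.1 this.symm).symm

end ContinuousLogarithms

section Crossings

theorem eventually_clog_div_eq_sub {w₀ : ℂ} (h : w₀ ∈ Complex.slitPlane) :
    ∀ᶠ w in 𝓝 w₀, Complex.log (w / w₀) = Complex.log w - Complex.log w₀ := by
  have hc : ContinuousAt (fun w ↦ |(Complex.log w - Complex.log w₀).im|) w₀ :=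
    (Complex.continuous_im.continuousAt.comp
      ((continuousAt_clog h).sub continuousAt_const)).abs
  have hlt : |(Complex.log w₀ - Complex.log w₀).im| < Real.pi := by simpa using Real.pi_pos
  have h0 := Complex.slitPlane_ne_zero h
  filter_upwards [hc.eventually_lt continuousAt_const hlt, isOpen_ne.mem_nhds h0] with w hw hw0
  have him := abs_lt.1 hw
  rw [← Complex.log_exp him.1 him.2.le, Complex.exp_sub, Complex.exp_log hw0, Complex.exp_log h0]

theorem mem_slitPlane_of_re_nonneg {w : ℂ} (h : 0 ≤ w.re) (h0 : w ≠ 0) :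
    w ∈ Complex.slitPlane := by
  rw [Complex.mem_slitPlane_iff]
  rcases h.lt_or_eq with h | h
  · exact Or.inl h
  · exact Or.inr fun him ↦ h0 (Complex.ext h.symm him)

theorem clog_im_of_re_eq_zero_of_pos {w : ℂ} (h : w.re = 0) (hw : 0 < w.im) :
    (Complex.log w).im = Real.pi / 2 := by
  rw [Complex.log_im, Complex.arg_eq_pi_div_two_iff]
  exact ⟨h, hw⟩

theorem clog_im_of_re_eq_zero_of_neg {w : ℂ} (h : w.re = 0) (hw : w.im < 0) :
    (Complex.log w).im = -(Real.pi / 2) := by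
  rw [Complex.log_im, Complex.arg_eq_neg_pi_div_two_iff.2 ⟨h, hw⟩]

/-- Two connected subsets of a vertical strip which join the two sides of the strip, and whose
order on the left side is opposite to their order on the right side, intersect. -/
theorem not_disjoint_of_crossing {a b : ℝ} {R E : Set ℂ} (hR : IsPreconnected R)
    (hRc : IsCompact R) (hE : IsPreconnected E) (hRs : ∀ z ∈ R, a ≤ z.re ∧ z.re ≤ b)
    (hEs : ∀ z ∈ E, a ≤ z.re ∧ z.re ≤ b) {l r l' r' : ℂ} (hl : l ∈ R) (hr : r ∈ R)
    (hl' : l' ∈ E) (hr' : r' ∈ E) (hla : l.re = a) (hrb : r.re = b) (hla' : l'.re = a)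
    (hrb' : r'.re = b) (hll : l'.im < l.im) (hrr : r.im < r'.im) : ¬ Disjoint R E := by
  intro hd
  have hne : ∀ z ∈ R, ∀ e ∈ E, z ≠ e := fun z hz e he h ↦ hd.le_bot ⟨hz, h ▸ he⟩
  have hre : ∀ e ∈ E, r - e ∈ Complex.slitPlane := fun e he ↦
    mem_slitPlane_of_re_nonneg (by simpa [hrb] using (hEs e he).2) (sub_ne_zero.2 (hne r hr e he))
  have hel : ∀ e ∈ E, e - l ∈ Complex.slitPlane := fun e he ↦
    mem_slitPlane_of_re_nonneg (by simpa [hla] using (hEs e he).1)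
      (sub_ne_zero.2 (hne l hl e he).symm)
  obtain ⟨g, hg, hgexp, hglr⟩ : ∃ g : ℂ → ℂ, ContinuousOn g R ∧
      (∀ z ∈ R, Complex.exp (g z) = (z - r') / (z - l')) ∧
      g r - g l = (Complex.log (r - r') - Complex.log (r' - l)) -
        (Complex.log (r - l') - Complex.log (l' - l)) := by
    refine hE.induction₂ (fun e e' ↦ ∃ g : ℂ → ℂ, ContinuousOn g R ∧
      (∀ z ∈ R, Complex.exp (g z) = (z - e') / (z - e)) ∧
      g r - g l = (Complex.log (r - e') - Complex.log (e' - l)) -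
        (Complex.log (r - e) - Complex.log (e - l))) ?_ ?_ ?_ hl' hr'
    · intro e he
      have hδ : ∃ δ > 0, ∀ z ∈ R, δ ≤ dist z e := by
        have heR : e ∈ Rᶜ := fun h ↦ hne e h e he rfl
        obtain ⟨δ, hδ, hball⟩ := Metric.isOpen_iff.1 hRc.isClosed.isOpen_compl e heR
        exact ⟨δ, hδ, fun z hz ↦ not_lt.1 fun h ↦ hball h hz⟩
      obtain ⟨δ, hδ, hδR⟩ := hδ
      have e1 : ∀ᶠ e' in 𝓝 e, Complex.log ((r - e') / (r - e)) =
          Complex.log (r - e') - Complex.log (r - e) :=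
        (by fun_prop : ContinuousAt (fun e' ↦ r - e') e).eventually
          (eventually_clog_div_eq_sub (hre e he))
      have e2 : ∀ᶠ e' in 𝓝 e, Complex.log ((e' - l) / (e - l)) =
          Complex.log (e' - l) - Complex.log (e - l) :=
        (by fun_prop : ContinuousAt (fun e' ↦ e' - l) e).eventually
          (eventually_clog_div_eq_sub (hel e he))
      filter_upwards [nhdsWithin_le_nhds e1, nhdsWithin_le_nhds e2,
        nhdsWithin_le_nhds (Metric.ball_mem_nhds e hδ), self_mem_nhdsWithin] with e' h1 h2 h3 he'
      have hs : ∀ z ∈ R, (z - e') / (z - e) ∈ Complex.slitPlane := fun z hz ↦ by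
        have hz0 : z - e ≠ 0 := sub_ne_zero.2 (hne z hz e he)
        have : (z - e') / (z - e) = 1 + (e - e') / (z - e) := by field_simp; ring
        rw [this]
        refine Complex.mem_slitPlane_of_norm_lt_one ?_
        rw [norm_div, div_lt_one (norm_pos_iff.2 hz0), ← dist_eq_norm, ← dist_eq_norm, dist_comm]
        exact (Metric.mem_ball.1 h3).trans_le (hδR z hz)
      refine ⟨fun z ↦ Complex.log ((z - e') / (z - e)), ?_, fun z hz ↦
        Complex.exp_log (Complex.slitPlane_ne_zero (hs z hz)), ?_⟩
      · refine ContinuousOn.clog (ContinuousOn.div (by fun_prop) (by fun_prop) fun z hz ↦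
          sub_ne_zero.2 (hne z hz e he)) hs
      · have : (l - e') / (l - e) = (e' - l) / (e - l) := by
          rw [← neg_sub, ← neg_sub e l, neg_div_neg_eq]
        simp only [this, h1, h2]
        ring
    · rintro e₁ e₂ e₃ _ he₂ _ ⟨g, hg, hgexp, hglr⟩ ⟨g', hg', hgexp', hglr'⟩
      refine ⟨fun z ↦ g z + g' z, hg.add hg', fun z hz ↦ ?_, ?_⟩
      · rw [Complex.exp_add, hgexp z hz, hgexp' z hz, mul_comm]
        exact div_mul_div_cancel₀ (sub_ne_zero.2 (hne z hz e₂ he₂))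
      · linear_combination hglr + hglr'
    · rintro e₁ e₂ _ _ ⟨g, hg, hgexp, hglr⟩
      refine ⟨fun z ↦ -g z, hg.neg, fun z hz ↦ ?_, ?_⟩
      · rw [Complex.exp_neg, hgexp z hz, inv_div]
      · linear_combination -hglr
  have hs1 : ∀ z ∈ R, r' - z ∈ Complex.slitPlane := fun z hz ↦
    mem_slitPlane_of_re_nonneg (by simpa [hrb'] using (hRs z hz).2)
      (sub_ne_zero.2 (hne z hz r' hr').symm)
  have hs2 : ∀ z ∈ R, z - l' ∈ Complex.slitPlane := fun z hz ↦
    mem_slitPlane_of_re_nonneg (by simpa [hla'] using (hRs z hz).1)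
      (sub_ne_zero.2 (hne z hz l' hl'))
  have hcomp := hR.sub_eq_sub_of_exp_eq hg
    (h := fun z ↦ Complex.log (r' - z) - Complex.log (z - l') + Real.pi * Complex.I)
    (((ContinuousOn.clog (by fun_prop) hs1).sub (ContinuousOn.clog (by fun_prop) hs2)).add
      continuousOn_const)
    (fun z hz ↦ by
      rw [hgexp z hz, Complex.exp_add, Complex.exp_sub, Complex.exp_pi_mul_I,
        Complex.exp_log (Complex.slitPlane_ne_zero (hs1 z hz)),
        Complex.exp_log (Complex.slitPlane_ne_zero (hs2 z hz))]
      ring) hr hl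
  have hfin : Complex.log (r' - r) + Complex.log (l - l') =
      Complex.log (r - r') + Complex.log (l' - l) := by
    linear_combination hglr - hcomp
  have him := congrArg Complex.im hfin
  rw [Complex.add_im, Complex.add_im,
    clog_im_of_re_eq_zero_of_pos (by simp [hrb, hrb']) (by simpa using hrr),
    clog_im_of_re_eq_zero_of_pos (by simp [hla, hla']) (by simpa using hll),
    clog_im_of_re_eq_zero_of_neg (by simp [hrb, hrb']) (by simpa using hrr),
    clog_im_of_re_eq_zero_of_neg (by simp [hla, hla']) (by simpa using hll)] at him
  linarith [Real.pi_pos]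

theorem IsPreconnected.union_of_mem_closure {α : Type*} [TopologicalSpace α] {R N : Set α}
    (hR : IsPreconnected R) (hN : IsPreconnected N) {y : α} (hyR : y ∈ R) (hyN : y ∈ closure N) :
    IsPreconnected (R ∪ N) := by
  have h : IsPreconnected (insert y N) :=
    hN.subset_closure (subset_insert _ _) (insert_subset hyN subset_closure)
  have h' := hR.union y hyR (mem_insert y N) h
  rwa [union_insert, insert_eq_of_mem (mem_union_left N hyR)] at h'

/-- `R` is a continuum in the slab `a ≤ u ≤ b` which meets both sides of the slab. -/
structure IsCrossing (u : ℂ → ℝ) (a b : ℝ) (R : Set ℂ) : Prop where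
  isCompact : IsCompact R
  isPreconnected : IsPreconnected R
  mem_slab : ∀ z ∈ R, a ≤ u z ∧ u z ≤ b
  exists_left : ∃ l ∈ R, u l = a
  exists_right : ∃ r ∈ R, u r = b

theorem false_of_three_crossings {a b : ℝ} {R₁ R₂ R₃ N : Set ℂ}
    (h₁ : IsCrossing Complex.re a b R₁) (h₂ : IsCrossing Complex.re a b R₂)
    (h₃ : IsCrossing Complex.re a b R₃) (hN : IsPreconnected N)
    (hNs : ∀ z ∈ N, a ≤ z.re ∧ z.re ≤ b) (h₁₂ : Disjoint R₂ R₁) (h₂₃ : Disjoint R₂ R₃)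
    (hN₂ : Disjoint R₂ N) (h₁N : (R₁ ∩ closure N).Nonempty) (h₃N : (R₃ ∩ closure N).Nonempty)
    {l₁ l₂ l₃ : ℂ} (hl₁ : l₁ ∈ R₁) (hl₂ : l₂ ∈ R₂) (hl₃ : l₃ ∈ R₃) (hl₁a : l₁.re = a)
    (hl₂a : l₂.re = a) (hl₃a : l₃.re = a) (hlt : l₁.im < l₂.im) (hlt' : l₂.im < l₃.im) :
    False := by
  obtain ⟨y₁, hy₁, hy₁N⟩ := h₁N
  obtain ⟨y₃, hy₃, hy₃N⟩ := h₃N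
  have hE : IsPreconnected (R₃ ∪ (R₁ ∪ N)) :=
    h₃.isPreconnected.union_of_mem_closure
      (h₁.isPreconnected.union_of_mem_closure hN hy₁ hy₁N) hy₃
      (closure_mono subset_union_right hy₃N)
  have hEs : ∀ z ∈ R₃ ∪ (R₁ ∪ N), a ≤ z.re ∧ z.re ≤ b := by
    rintro z (hz | hz | hz)
    exacts [h₃.mem_slab z hz, h₁.mem_slab z hz, hNs z hz]
  have hd : Disjoint R₂ (R₃ ∪ (R₁ ∪ N)) := h₂₃.union_right (h₁₂.union_right hN₂)
  obtain ⟨r₂, hr₂, hr₂b⟩ := h₂.exists_right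
  obtain ⟨r₃, hr₃, hr₃b⟩ := h₃.exists_right
  have hne : r₂.im ≠ r₃.im := fun h ↦
    h₂₃.le_bot ⟨hr₂, (Complex.ext (hr₂b.trans hr₃b.symm) h : r₂ = r₃) ▸ hr₃⟩
  rcases hne.lt_or_gt with h | h
  · exact not_disjoint_of_crossing h₂.isPreconnected h₂.isCompact hE h₂.mem_slab hEs hl₂ hr₂
      (Or.inr (Or.inl hl₁)) (Or.inl hr₃) hl₂a hr₂b hl₁a hr₃b hlt h hd
  · have hconj : Continuous (starRingEnd ℂ) := Complex.continuous_conj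
    refine not_disjoint_of_crossing (h₂.isPreconnected.image _ hconj.continuousOn)
      (h₂.isCompact.image hconj) (hE.image _ hconj.continuousOn) ?_ ?_
      (mem_image_of_mem _ hl₂) (mem_image_of_mem _ hr₂) (mem_image_of_mem _ (Or.inl hl₃))
      (mem_image_of_mem _ (Or.inl hr₃)) (a := a) (b := b) (by simpa) (by simpa) (by simpa)
      (by simpa) (by simpa) (by simpa) ?_
    · rintro _ ⟨z, hz, rfl⟩
      simpa using h₂.mem_slab z hz
    · rintro _ ⟨z, hz, rfl⟩
      simpa using hEs z hz
    · exact (disjoint_image_iff (star_injective (R := ℂ))).2 hd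

/-- If `Ω` has property S, then its boundary contains only finitely many disjoint continua
crossing a given vertical strip. -/
theorem PropertyS.finite_re_crossings {Ω : Set ℂ} (hS : PropertyS Ω) (hΩ : IsOpen Ω)
    (hb : Bornology.IsBounded Ω) {a b : ℝ} (hab : a < b) {𝓡 : Set (Set ℂ)}
    (h𝓡 : ∀ R ∈ 𝓡, R ⊆ frontier Ω ∧ IsCrossing Complex.re a b R)
    (hd : 𝓡.PairwiseDisjoint id) : 𝓡.Finite := by
  by_contra hinf
  obtain ⟨k, N, hN, hNΩ⟩ := hS ((b - a) / 4) (by linarith)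
  set m := (a + b) / 2 with hm
  have hcov : 𝓡 ⊆ ⋃ j, {R | R ∈ 𝓡 ∧ ∃ y ∈ R, y.re = m ∧ y ∈ closure (N j)} := by
    intro R hR
    obtain ⟨hRf, hRc⟩ := h𝓡 R hR
    obtain ⟨l, hl, hla⟩ := hRc.exists_left
    obtain ⟨r, hr, hrb⟩ := hRc.exists_right
    obtain ⟨y, hy, hym⟩ := hRc.isPreconnected.intermediate_value hl hr
      Complex.continuous_re.continuousOn (⟨by linarith, by linarith⟩ : m ∈ Icc l.re r.re)
    have hyΩ : y ∈ closure Ω := frontier_subset_closure (hRf hy)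
    rw [← hNΩ, closure_iUnion_of_finite] at hyΩ
    obtain ⟨j, hj⟩ := mem_iUnion.1 hyΩ
    exact mem_iUnion.2 ⟨j, hR, y, hy, hym, hj⟩
  obtain ⟨j, hj⟩ : ∃ j, {R | R ∈ 𝓡 ∧ ∃ y ∈ R, y.re = m ∧ y ∈ closure (N j)}.Infinite := by
    by_contra hcon
    push Not at hcon
    exact hinf ((finite_iUnion hcon).subset hcov)
  have hNj : N j ⊆ Ω := hNΩ ▸ subset_iUnion N j
  obtain ⟨F, hF, hF3⟩ := hj.exists_subset_card_eq 3
  have hNs : ∀ z ∈ N j, a ≤ z.re ∧ z.re ≤ b := by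
    intro z hz
    obtain ⟨R, hR⟩ := hj.nonempty
    obtain ⟨-, y, -, hym, hy⟩ := hR
    have h1 : dist y z ≤ diam (N j) := by
      rw [← diam_closure]
      exact dist_le_diam_of_mem (hb.subset hNj).closure hy (subset_closure hz)
    have h2 : |(y - z).re| ≤ dist y z := (Complex.abs_re_le_norm _).trans_eq (dist_eq_norm _ _).symm
    have h3 := abs_le.1 (h2.trans (h1.trans (hN j).2.le))
    rw [Complex.sub_re, hym] at h3
    constructor <;> linarith [h3.1, h3.2]
  have key : ∀ R₁ ∈ F, ∀ R₂ ∈ F, ∀ R₃ ∈ F, R₂ ≠ R₁ → R₂ ≠ R₃ → ∀ l₁ ∈ R₁, ∀ l₂ ∈ R₂, ∀ l₃ ∈ R₃,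
      l₁.re = a → l₂.re = a → l₃.re = a → l₁.im < l₂.im → l₂.im < l₃.im → False := by
    intro R₁ h₁ R₂ h₂ R₃ h₃ h₂₁ h₂₃ l₁ hl₁ l₂ hl₂ l₃ hl₃ e₁ e₂ e₃ hlt hlt'
    obtain ⟨h₁𝓡, y₁, hy₁, -, hy₁N⟩ := hF h₁
    obtain ⟨h₂𝓡, -⟩ := hF h₂
    obtain ⟨h₃𝓡, y₃, hy₃, -, hy₃N⟩ := hF h₃
    refine false_of_three_crossings (h𝓡 _ h₁𝓡).2 (h𝓡 _ h₂𝓡).2 (h𝓡 _ h₃𝓡).2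
      (hN j).1.isPreconnected hNs (hd h₂𝓡 h₁𝓡 h₂₁) (hd h₂𝓡 h₃𝓡 h₂₃) ?_ ⟨y₁, hy₁, hy₁N⟩
      ⟨y₃, hy₃, hy₃N⟩ hl₁ hl₂ hl₃ e₁ e₂ e₃ hlt hlt'
    refine disjoint_left.2 fun z hz hzN ↦ ?_
    have := (h𝓡 _ h₂𝓡).1 hz
    rw [hΩ.frontier_eq] at this
    exact this.2 (hNj hzN)
  obtain ⟨R₁, R₂, R₃, h₁₂, h₁₃, h₂₃, rfl⟩ := Finset.card_eq_three.1 hF3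
  have m₁ : R₁ ∈ ({R₁, R₂, R₃} : Finset (Set ℂ)) := by simp
  have m₂ : R₂ ∈ ({R₁, R₂, R₃} : Finset (Set ℂ)) := by simp
  have m₃ : R₃ ∈ ({R₁, R₂, R₃} : Finset (Set ℂ)) := by simp
  obtain ⟨l₁, hl₁, e₁⟩ := (h𝓡 _ (hF m₁).1).2.exists_left
  obtain ⟨l₂, hl₂, e₂⟩ := (h𝓡 _ (hF m₂).1).2.exists_left
  obtain ⟨l₃, hl₃, e₃⟩ := (h𝓡 _ (hF m₃).1).2.exists_left
  have hne : ∀ {R R' : Set ℂ} {l l' : ℂ}, R ∈ 𝓡 → R' ∈ 𝓡 → R ≠ R' → l ∈ R → l' ∈ R' →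
      l.re = a → l'.re = a → l.im ≠ l'.im := by
    intro R R' l l' hR hR' hRR hl hl' e e' him
    exact (hd hR hR' hRR).le_bot ⟨hl, (Complex.ext (e.trans e'.symm) him : l = l') ▸ hl'⟩
  have n₁₂ := hne (hF m₁).1 (hF m₂).1 h₁₂ hl₁ hl₂ e₁ e₂
  have n₁₃ := hne (hF m₁).1 (hF m₃).1 h₁₃ hl₁ hl₃ e₁ e₃
  have n₂₃ := hne (hF m₂).1 (hF m₃).1 h₂₃ hl₂ hl₃ e₂ e₃
  rcases n₁₂.lt_or_gt with a₁ | a₁ <;> rcases n₁₃.lt_or_gt with a₂ | a₂ <;>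
    rcases n₂₃.lt_or_gt with a₃ | a₃
  · exact key _ m₁ _ m₂ _ m₃ h₁₂.symm h₂₃ _ hl₁ _ hl₂ _ hl₃ e₁ e₂ e₃ a₁ a₃
  · exact key _ m₁ _ m₃ _ m₂ h₁₃.symm h₂₃.symm _ hl₁ _ hl₃ _ hl₂ e₁ e₃ e₂ a₂ a₃
  · linarith
  · exact key _ m₃ _ m₁ _ m₂ h₁₃ h₁₂ _ hl₃ _ hl₁ _ hl₂ e₃ e₁ e₂ a₂ a₁
  · exact key _ m₂ _ m₁ _ m₃ h₁₂ h₁₃ _ hl₂ _ hl₁ _ hl₃ e₂ e₁ e₃ a₁ a₂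
  · linarith
  · exact key _ m₂ _ m₃ _ m₁ h₂₃.symm h₁₃.symm _ hl₂ _ hl₃ _ hl₁ e₂ e₃ e₁ a₃ a₂
  · exact key _ m₃ _ m₂ _ m₁ h₂₃ h₁₂.symm _ hl₃ _ hl₂ _ hl₁ e₃ e₂ e₁ a₃ a₁

theorem PropertyS.image_isometryEquiv {Ω : Set ℂ} (hS : PropertyS Ω) (φ : ℂ ≃ᵢ ℂ) :
    PropertyS (φ '' Ω) := by
  intro ε hε
  obtain ⟨k, N, hN, hNΩ⟩ := hS ε hε
  refine ⟨k, fun i ↦ φ '' N i, fun i ↦ ⟨(hN i).1.image _ φ.continuous.continuousOn, ?_⟩, ?_⟩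
  · rw [φ.isometry.diam_image]
    exact (hN i).2
  · rw [← image_iUnion, hNΩ]

theorem PropertyS.finite_im_crossings {Ω : Set ℂ} (hS : PropertyS Ω) (hΩ : IsOpen Ω)
    (hb : Bornology.IsBounded Ω) {a b : ℝ} (hab : a < b) {𝓡 : Set (Set ℂ)}
    (h𝓡 : ∀ R ∈ 𝓡, R ⊆ frontier Ω ∧ IsCrossing Complex.im a b R)
    (hd : 𝓡.PairwiseDisjoint id) : 𝓡.Finite := by
  have hnI : -Complex.I ∈ Submonoid.unitSphere ℂ := by simp [Submonoid.unitSphere]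
  let φ : ℂ ≃ᵢ ℂ := (rotation (⟨-Complex.I, hnI⟩ : Circle)).toIsometryEquiv
  have hφ : ∀ z, (φ z).re = z.im := fun z ↦ by
    change (-Complex.I * z).re = z.im
    simp
  have hfr : frontier (φ '' Ω) = φ '' frontier Ω := (φ.toHomeomorph.image_frontier Ω).symm
  refine Finite.of_finite_image (f := fun R ↦ φ '' R) ?_ (φ.injective.image_injective.injOn)
  refine (hS.image_isometryEquiv φ).finite_re_crossings (φ.toHomeomorph.isOpenMap Ω hΩ)
    (φ.isometry.lipschitz.isBounded_image hb) hab ?_ ?_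
  · rintro _ ⟨R, hR, rfl⟩
    obtain ⟨hRf, h⟩ := h𝓡 R hR
    obtain ⟨l, hl, hla⟩ := h.exists_left
    obtain ⟨r, hr, hrb⟩ := h.exists_right
    refine ⟨hfr ▸ image_mono hRf, h.isCompact.image φ.continuous,
      h.isPreconnected.image _ φ.continuous.continuousOn, ?_,
      ⟨_, mem_image_of_mem _ hl, (hφ l).trans hla⟩, ⟨_, mem_image_of_mem _ hr, (hφ r).trans hrb⟩⟩
    rintro _ ⟨z, hz, rfl⟩
    rw [hφ]
    exact h.mem_slab z hz
  · rintro _ ⟨R, hR, rfl⟩ _ ⟨R', hR', rfl⟩ hne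
    exact (disjoint_image_iff φ.injective).2 (hd hR hR' fun h ↦ hne (h ▸ rfl))

end Crossings

section PeanoOfPropertyS

/-- Every family of disjoint continua in `K` crossing a given slab of `u` is finite. -/
def HasFiniteCrossings (K : Set ℂ) (u : ℂ → ℝ) : Prop :=
  ∀ ⦃a b : ℝ⦄, a < b → ∀ 𝓡 : Set (Set ℂ), (∀ R ∈ 𝓡, R ⊆ K ∧ IsCrossing u a b R) →
    𝓡.PairwiseDisjoint id → 𝓡.Finite

/-- `Q` is a continuum contained in `K`. -/
structure IsSubcontinuum (K Q : Set ℂ) : Prop where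
  subset : Q ⊆ K
  isCompact : IsCompact Q
  isPreconnected : IsPreconnected Q

theorem IsCompact.isSubcontinuum_connectedComponentIn {K : Set ℂ} (hK : IsCompact K) (x : ℂ) :
    IsSubcontinuum K (connectedComponentIn K x) where
  subset := connectedComponentIn_subset K x
  isCompact := hK.of_isClosed_subset (hK.isClosed.isClosed_connectedComponentIn x)
    (connectedComponentIn_subset K x)
  isPreconnected := isPreconnected_connectedComponentIn

theorem pairwiseDisjoint_connectedComponentIn {α : Type*} [TopologicalSpace α] (K : Set α)
    {𝓠 : Set (Set α)} (h𝓠 : ∀ Q ∈ 𝓠, ∃ x, Q = connectedComponentIn K x) :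
    𝓠.PairwiseDisjoint id := by
  intro Q hQ Q' hQ' hne
  obtain ⟨x, rfl⟩ := h𝓠 Q hQ
  obtain ⟨y, rfl⟩ := h𝓠 Q' hQ'
  refine disjoint_left.2 fun z hz hz' ↦ hne ?_
  rw [connectedComponentIn_eq hz, connectedComponentIn_eq hz']

theorem HasFiniteCrossings.finite_of_slab {K : Set ℂ} {u : ℂ → ℝ} (h : HasFiniteCrossings K u)
    (hu : Continuous u) {a b : ℝ} (hab : a < b) {𝓠 : Set (Set ℂ)}
    (h𝓠 : ∀ Q ∈ 𝓠, IsSubcontinuum K Q ∧ (∃ p ∈ Q, u p ≤ a) ∧ ∃ q ∈ Q, b ≤ u q)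
    (hd : 𝓠.PairwiseDisjoint id) : 𝓠.Finite := by
  have hex : ∀ Q ∈ 𝓠, ∃ R ⊆ Q, IsCrossing u a b R := by
    intro Q hQ
    obtain ⟨hQK, ⟨p, hp, hpa⟩, q, hq, hqb⟩ := h𝓠 Q hQ
    obtain ⟨R, hRQ, h1, h2, h3, h4, h5⟩ :=
      exists_crossing_subset hQK.isPreconnected hQK.isCompact hu hab.le hp hpa hq hqb
    exact ⟨R, hRQ, h1, h2, h3, h4, h5⟩
  choose! R hRQ hR using hex
  have hdR : ∀ Q ∈ 𝓠, ∀ Q' ∈ 𝓠, Q ≠ Q' → Disjoint (R Q) (R Q') := fun Q hQ Q' hQ' hne ↦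
    (hd hQ hQ' hne).mono (hRQ Q hQ) (hRQ Q' hQ')
  refine Finite.of_finite_image (f := R) (h hab _ ?_ ?_) ?_
  · rintro _ ⟨Q, hQ, rfl⟩
    exact ⟨(hRQ Q hQ).trans (h𝓠 Q hQ).1.subset, hR Q hQ⟩
  · rintro _ ⟨Q, hQ, rfl⟩ _ ⟨Q', hQ', rfl⟩ hne
    exact hdR Q hQ Q' hQ' fun h ↦ hne (h ▸ rfl)
  · intro Q hQ Q' hQ' heq
    by_contra hne
    have hdis := hdR Q hQ Q' hQ' hne
    obtain ⟨l, hl, -⟩ := (hR Q hQ).exists_left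
    exact hdis.le_bot ⟨hl, heq ▸ hl⟩

theorem HasFiniteCrossings.finite_of_width {K : Set ℂ} {u : ℂ → ℝ} (h : HasFiniteCrossings K u)
    (hu : Continuous u) (hK : IsCompact K) {c : ℝ} (hc : 0 < c) {𝓠 : Set (Set ℂ)}
    (h𝓠 : ∀ Q ∈ 𝓠, IsSubcontinuum K Q ∧ ∃ p ∈ Q, ∃ q ∈ Q, c ≤ |u p - u q|)
    (hd : 𝓠.PairwiseDisjoint id) : 𝓠.Finite := by
  obtain ⟨M, hM⟩ := hK.exists_bound_of_continuousOn hu.continuousOn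
  have hc2 : 0 < c / 2 := by linarith
  have hcov : 𝓠 ⊆ ⋃ n ∈ Icc ⌈-M / (c / 2)⌉ ⌈M / (c / 2)⌉, {Q | Q ∈ 𝓠 ∧
      (∃ p ∈ Q, u p ≤ n * (c / 2)) ∧ ∃ q ∈ Q, (n + 1) * (c / 2) ≤ u q} := by
    intro Q hQ
    obtain ⟨hQK, hex⟩ := h𝓠 Q hQ
    have hex' : ∃ p ∈ Q, ∃ q ∈ Q, c ≤ u q - u p := by
      obtain ⟨p, hp, q, hq, hpq⟩ := hex
      rcases le_abs.1 hpq with h | h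
      · exact ⟨q, hq, p, hp, h⟩
      · exact ⟨p, hp, q, hq, by linarith⟩
    obtain ⟨p, hp, q, hq, hpq⟩ := hex'
    have hpM := abs_le.1 (hM p (hQK.subset hp))
    have h1 := Int.le_ceil (u p / (c / 2))
    have h2 := Int.ceil_lt_add_one (u p / (c / 2))
    rw [div_le_iff₀ hc2] at h1
    have h3 : (⌈u p / (c / 2)⌉ : ℝ) * (c / 2) < u p + c / 2 := by
      calc _ < (u p / (c / 2) + 1) * (c / 2) := by gcongr
        _ = _ := by field_simp
    refine mem_biUnion (x := ⌈u p / (c / 2)⌉) ⟨?_, ?_⟩ ⟨hQ, ⟨p, hp, h1⟩, q, hq, by linarith⟩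
    · exact Int.ceil_mono (by gcongr; exact hpM.1)
    · exact Int.ceil_mono (by gcongr; exact hpM.2)
  refine ((finite_Icc _ _).biUnion fun n _ ↦ ?_).subset hcov
  refine h.finite_of_slab hu (a := n * (c / 2)) (b := (n + 1) * (c / 2)) (by linarith)
    (fun Q hQ ↦ ⟨(h𝓠 Q hQ.1).1, hQ.2⟩) (hd.subset fun Q hQ ↦ hQ.1)

theorem finite_setOf_lt_diam {K : Set ℂ} (hK : IsCompact K) (hre : HasFiniteCrossings K Complex.re)
    (him : HasFiniteCrossings K Complex.im) {c : ℝ} (hc : 0 < c) :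
    {Q : Set ℂ | (∃ x ∈ K, Q = connectedComponentIn K x) ∧ c < diam Q}.Finite := by
  have hcomp : ∀ u : ℂ → ℝ, {Q : Set ℂ | (∃ x, Q = connectedComponentIn K x) ∧
      ∃ p ∈ Q, ∃ q ∈ Q, c / 2 ≤ |u p - u q|}.PairwiseDisjoint id := fun u ↦
    pairwiseDisjoint_connectedComponentIn K fun Q hQ ↦ hQ.1
  have hfin : ∀ u : ℂ → ℝ, Continuous u → HasFiniteCrossings K u →
      {Q : Set ℂ | (∃ x, Q = connectedComponentIn K x) ∧
        ∃ p ∈ Q, ∃ q ∈ Q, c / 2 ≤ |u p - u q|}.Finite := by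
    refine fun u hu h ↦ h.finite_of_width hu hK (by linarith : 0 < c / 2) ?_ (hcomp u)
    rintro Q ⟨⟨x, rfl⟩, hex⟩
    exact ⟨hK.isSubcontinuum_connectedComponentIn x, hex⟩
  refine ((hfin _ Complex.continuous_re hre).union (hfin _ Complex.continuous_im him)).subset ?_
  rintro Q ⟨⟨x, -, hx⟩, hQ⟩
  obtain ⟨p, hp, q, hq, hpq⟩ : ∃ p ∈ Q, ∃ q ∈ Q, c < dist p q := by
    by_contra! hcon
    exact hQ.not_ge (diam_le_of_forall_dist_le hc.le hcon)
  rw [dist_eq_norm] at hpq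
  have hsum := Complex.norm_le_abs_re_add_abs_im (p - q)
  rw [Complex.sub_re, Complex.sub_im] at hsum
  rcases le_or_gt (c / 2) |p.re - q.re| with h | h
  · exact Or.inl ⟨⟨x, hx⟩, p, hp, q, hq, h⟩
  · exact Or.inr ⟨⟨x, hx⟩, p, hp, q, hq, by linarith⟩

/-- The distance to `x` in the supremum norm of `ℝ²`. -/
def supDist (x z : ℂ) : ℝ := max |z.re - x.re| |z.im - x.im|

theorem continuous_supDist (x : ℂ) : Continuous (supDist x) := by
  unfold supDist
  fun_prop

theorem supDist_self (x : ℂ) : supDist x x = 0 := by simp [supDist]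

theorem dist_le_two_mul_supDist (x z : ℂ) : dist z x ≤ 2 * supDist x z := by
  rw [dist_eq_norm]
  refine (Complex.norm_le_abs_re_add_abs_im _).trans ?_
  rw [Complex.sub_re, Complex.sub_im, two_mul]
  exact add_le_add (le_max_left _ _) (le_max_right _ _)

theorem finite_components_of_square {K P : Set ℂ} (hre : HasFiniteCrossings K Complex.re)
    (him : HasFiniteCrossings K Complex.im) (hP : IsSubcontinuum K P) {x : ℂ} {η : ℝ}
    (hη : 0 < η) (hex : ∃ q ∈ P, η ≤ supDist x q) :
    {D : Set ℂ | ∃ y ∈ P, supDist x y ≤ η / 2 ∧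
      D = connectedComponentIn (P ∩ {z | supDist x z ≤ η}) y}.Finite := by
  set X := P ∩ {z | supDist x z ≤ η}
  have hX : IsCompact X :=
    hP.isCompact.inter_right (isClosed_le (continuous_supDist x) continuous_const)
  have hfin : ∀ u : ℂ → ℝ, Continuous u → HasFiniteCrossings K u → ∀ a b, a < b →
      {D : Set ℂ | (∃ y, D = connectedComponentIn X y) ∧
        (∃ p ∈ D, u p ≤ a) ∧ ∃ q ∈ D, b ≤ u q}.Finite := by
    intro u hu h a b hab
    refine h.finite_of_slab hu hab ?_ (pairwiseDisjoint_connectedComponentIn X fun D hD ↦ hD.1)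
    rintro D ⟨⟨y, rfl⟩, hD⟩
    have hD' := hX.isSubcontinuum_connectedComponentIn y
    exact ⟨⟨hD'.subset.trans (inter_subset_left.trans hP.subset), hD'.isCompact,
      hD'.isPreconnected⟩, hD⟩
  refine (((hfin _ Complex.continuous_re hre (x.re + η / 2) (x.re + η) (by linarith)).union
    (hfin _ Complex.continuous_re hre (x.re - η) (x.re - η / 2) (by linarith))).union
    ((hfin _ Complex.continuous_im him (x.im + η / 2) (x.im + η) (by linarith)).union
    (hfin _ Complex.continuous_im him (x.im - η) (x.im - η / 2) (by linarith)))).subset ?_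
  rintro D ⟨y, hy, hyη, rfl⟩
  have hyD : y ∈ connectedComponentIn X y :=
    mem_connectedComponentIn ⟨hy, hyη.trans (by linarith)⟩
  obtain ⟨w, hwD, hw⟩ := exists_mem_connectedComponentIn_le hP.isPreconnected hP.isCompact
    (continuous_supDist x) hy (hyη.trans (by linarith)) hex
  have hyre := abs_le.1 ((le_max_left _ _).trans hyη)
  have hyim := abs_le.1 ((le_max_right _ _).trans hyη)
  rcases max_choice |w.re - x.re| |w.im - x.im| with h | h
  · rw [supDist, h] at hw
    rcases (abs_eq hη.le).1 hw with h' | h'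
    · exact Or.inl (Or.inl ⟨⟨y, rfl⟩, ⟨y, hyD, by linarith [hyre.2]⟩, w, hwD, by linarith⟩)
    · exact Or.inl (Or.inr ⟨⟨y, rfl⟩, ⟨w, hwD, by linarith⟩, y, hyD, by linarith [hyre.1]⟩)
  · rw [supDist, h] at hw
    rcases (abs_eq hη.le).1 hw with h' | h'
    · exact Or.inr (Or.inl ⟨⟨y, rfl⟩, ⟨y, hyD, by linarith [hyim.2]⟩, w, hwD, by linarith⟩)
    · exact Or.inr (Or.inr ⟨⟨y, rfl⟩, ⟨w, hwD, by linarith⟩, y, hyD, by linarith [hyim.1]⟩)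

theorem component_square_mem_nhdsWithin {K P : Set ℂ} (hre : HasFiniteCrossings K Complex.re)
    (him : HasFiniteCrossings K Complex.im) (hP : IsSubcontinuum K P) {x : ℂ} (hx : x ∈ P) {η : ℝ}
    (hη : 0 < η) : connectedComponentIn (P ∩ {z | supDist x z ≤ η}) x ∈ 𝓝[P] x := by
  set X := P ∩ {z | supDist x z ≤ η} with hXdef
  have hxX : x ∈ X := ⟨hx, (supDist_self x).trans_le hη.le⟩
  by_cases hex : ∃ q ∈ P, η ≤ supDist x q
  · have hXc : IsClosed X := (hP.isCompact.inter_right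
      (isClosed_le (continuous_supDist x) continuous_const)).isClosed
    have hfin := (finite_components_of_square hre him hP hη hex).subset
      (sep_subset _ fun D ↦ x ∉ D)
    have hcl : IsClosed (⋃₀ _) := sUnion_eq_biUnion ▸ hfin.isClosed_biUnion fun D hD ↦ by
      obtain ⟨⟨y, -, -, rfl⟩, -⟩ := hD
      exact hXc.isClosed_connectedComponentIn y
    have hmem := hcl.isOpen_compl.mem_nhds (x := x) fun ⟨D, hD, hxD⟩ ↦ hD.2 hxD
    have hlt : ∀ᶠ z in 𝓝 x, supDist x z < η / 2 :=
      (continuous_supDist x).continuousAt.eventually_lt continuousAt_const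
        (by rw [supDist_self]; linarith)
    filter_upwards [nhdsWithin_le_nhds hmem, nhdsWithin_le_nhds hlt, self_mem_nhdsWithin]
      with y hy hyη hyP
    have hyX : y ∈ X := ⟨hyP, (hyη.trans (by linarith)).le⟩
    by_contra hyV
    refine hy ⟨connectedComponentIn X y, ⟨⟨y, hyP, hyη.le, rfl⟩, fun hxy ↦ hyV ?_⟩,
      mem_connectedComponentIn hyX⟩
    rw [← connectedComponentIn_eq hxy]
    exact mem_connectedComponentIn hyX
  · push Not at hex
    have hXP : X = P := inter_eq_left.2 fun z hz ↦ (hex z hz).le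
    rw [hXP]
    filter_upwards [self_mem_nhdsWithin] with y hy
    exact hP.isPreconnected.subset_connectedComponentIn hx Subset.rfl hy

theorem locallyConnectedSpace_of_hasFiniteCrossings {K P : Set ℂ}
    (hre : HasFiniteCrossings K Complex.re) (him : HasFiniteCrossings K Complex.im)
    (hP : IsSubcontinuum K P) : LocallyConnectedSpace P := by
  rw [locallyConnectedSpace_iff_connected_subsets]
  rintro ⟨x, hx⟩ U hU
  obtain ⟨r, hr, hrU⟩ := Metric.mem_nhds_iff.1 hU
  set V := connectedComponentIn (P ∩ {z | supDist x z ≤ r / 3}) x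
  have hVP : V ⊆ P ∩ {z | supDist x z ≤ r / 3} := connectedComponentIn_subset _ _
  refine ⟨(↑) ⁻¹' V, preimage_coe_mem_nhds_subtype.2
    (component_square_mem_nhdsWithin hre him hP hx (by positivity)), ?_, ?_⟩
  · rw [← Topology.IsInducing.subtypeVal.isPreconnected_image, Subtype.image_preimage_coe,
      inter_eq_right.2 (hVP.trans inter_subset_left)]
    exact isPreconnected_connectedComponentIn
  · intro z hz
    refine hrU (mem_ball.2 ?_)
    have h1 : supDist x z ≤ r / 3 := (hVP hz).2
    have h2 := dist_le_two_mul_supDist x z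
    rw [Subtype.dist_eq]
    linarith

theorem PropertyS.isPeanoCompactum_frontier {Ω : Set ℂ} (hS : PropertyS Ω) (hΩ : IsOpen Ω)
    (hb : Bornology.IsBounded Ω) : IsPeanoCompactum (frontier Ω) := by
  have hK : IsCompact (frontier Ω) :=
    isCompact_of_isClosed_isBounded isClosed_frontier (hb.closure.subset frontier_subset_closure)
  have hre : HasFiniteCrossings (frontier Ω) Complex.re := fun _ _ hab _ h hd ↦
    hS.finite_re_crossings hΩ hb hab h hd
  have him : HasFiniteCrossings (frontier Ω) Complex.im := fun _ _ hab _ h hd ↦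
    hS.finite_im_crossings hΩ hb hab h hd
  exact ⟨hK, fun x _ ↦ locallyConnectedSpace_of_hasFiniteCrossings hre him
    (hK.isSubcontinuum_connectedComponentIn x), fun c hc ↦ finite_setOf_lt_diam hK hre him hc⟩

end PeanoOfPropertyS

section PlanarLogarithms

theorem IsClosed.exists_continuous_extension {α : Type*} [TopologicalSpace α] [NormalSpace α]
    {s : Set α} (hs : IsClosed s) {g : α → ℂ} (hg : ContinuousOn g s) :
    ∃ G : α → ℂ, Continuous G ∧ EqOn G g s := by
  obtain ⟨G, hG⟩ := ContinuousMap.exists_restrict_eq hs ⟨s.domRestrict g, hg.domRestrict⟩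
  exact ⟨G, G.continuous, fun z hz ↦ congrArg (fun k : C(s, ℂ) ↦ k ⟨z, hz⟩) hG⟩

theorem HasContLog.exists_clopen_of_connectedComponentIn {X : Set ℂ} (hX : IsCompact X)
    {f : ℂ → ℂ} (hf : ContinuousOn f X) {x : ℂ} (h : HasContLog f (connectedComponentIn X x)) :
    ∃ V ⊆ X, IsClosed V ∧ IsClosed (X \ V) ∧ connectedComponentIn X x ⊆ V ∧ HasContLog f V := by
  have hC := hX.isClosed.isClosed_connectedComponentIn x
  have hCX := connectedComponentIn_subset X x
  obtain ⟨g, hg, hgf⟩ := h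
  obtain ⟨G, hG, hGg⟩ := hC.exists_continuous_extension hg
  have hfG : ContinuousOn (fun z ↦ f z * Complex.exp (-G z)) X := by fun_prop
  have hB : IsClosed (X ∩ {z | 1 ≤ ‖f z * Complex.exp (-G z) - 1‖}) :=
    (hfG.sub continuousOn_const).norm.preimage_isClosed_of_isClosed hX.isClosed isClosed_Ici
  obtain ⟨V, hVX, hV, hV', hCV, hVB⟩ := hX.exists_isClosed_separation hC hB hCX fun a ha ↦ by
    rw [← connectedComponentIn_eq ha]
    refine disjoint_left.2 fun z hz hzB ↦ ?_
    have hz1 : 1 ≤ ‖f z * Complex.exp (-G z) - 1‖ := hzB.2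
    rw [← hgf z hz, hGg hz, ← Complex.exp_add] at hz1
    norm_num at hz1
  refine ⟨V, hVX, hV, hV', hCV, ?_⟩
  have hlog : HasContLog (fun z ↦ f z * Complex.exp (-G z)) V :=
    of_norm_sub_one_lt (hfG.mono hVX) fun z hz ↦
      not_le.1 fun hz1 ↦ hVB.le_bot ⟨hz, hVX hz, hz1⟩
  refine (hlog.mul ⟨G, hG.continuousOn, fun z _ ↦ rfl⟩).congr fun z _ ↦ ?_
  simp only [mul_assoc, ← Complex.exp_add]
  simp

/-- A function on a plane compactum has a continuous logarithm if it has one on each connected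
component. -/
theorem HasContLog.of_connectedComponentIn {X : Set ℂ} (hX : IsCompact X) {f : ℂ → ℂ}
    (hf : ContinuousOn f X) (h : ∀ x ∈ X, HasContLog f (connectedComponentIn X x)) :
    HasContLog f X := by
  obtain ⟨V, hVX, -, -, hXV, hV⟩ : ∃ V ⊆ X, IsClosed V ∧ IsClosed (X \ V) ∧ X ∩ X ⊆ V ∧
      HasContLog f V := by
    refine hX.induction_on (p := fun s ↦ ∃ V ⊆ X, IsClosed V ∧ IsClosed (X \ V) ∧ s ∩ X ⊆ V ∧
      HasContLog f V) ?_ ?_ ?_ ?_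
    · exact ⟨∅, empty_subset _, isClosed_empty, by simpa using hX.isClosed, by simp,
        fun _ ↦ 0, continuousOn_empty _, by simp⟩
    · rintro s t hst ⟨V, hVX, hV, hV', htV, hlog⟩
      exact ⟨V, hVX, hV, hV', (inter_subset_inter_left X hst).trans htV, hlog⟩
    · rintro s t ⟨V, hVX, hV, hV', hsV, hlog⟩ ⟨W, hWX, hW, hW', htW, hlog'⟩
      have hWV : W ∩ (X \ V) = W \ V := by
        ext z
        exact ⟨fun hz ↦ ⟨hz.1, hz.2.2⟩, fun hz ↦ ⟨hz.1, hWX hz.1, hz.2⟩⟩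
      refine ⟨V ∪ W, union_subset hVX hWX, hV.union hW, ?_, ?_, ?_⟩
      · rw [← sdiff_inter_sdiff]
        exact hV'.inter hW'
      · rw [union_inter_distrib_right]
        exact union_subset_union hsV htW
      · rw [← union_sdiff_self, ← hWV]
        refine union_of_disjoint hV (hW.inter hV') ?_ hlog (hlog'.mono inter_subset_left)
        rw [hWV]
        exact disjoint_sdiff_right
    · intro x hx
      obtain ⟨V, hVX, hV, hV', hCV, hlog⟩ :=
        exists_clopen_of_connectedComponentIn hX hf (h x hx)
      refine ⟨V, ?_, V, hVX, hV, hV', inter_subset_left, hlog⟩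
      filter_upwards [self_mem_nhdsWithin, nhdsWithin_le_nhds (hV'.isOpen_compl.mem_nhds
        (x := x) fun hx' ↦ hx'.2 (hCV (mem_connectedComponentIn hx)))] with z hz hzV
      by_contra hcon
      exact hzV ⟨hz, hcon⟩
  exact hV.mono (by simpa using hXV)

theorem HasContLog.of_continuous {h : ℂ → ℂ} (hh : Continuous h) (h0 : ∀ z, h z ≠ 0)
    {X : Set ℂ} (hX : IsCompact X) : HasContLog h X := by
  have := (div_of_isPreconnected (T := ℝ) (E := univ) (F := fun t z ↦ h (t * z))
    isPreconnected_univ hX (by fun_prop) (fun _ _ _ _ ↦ h0 _) (mem_univ 1) (mem_univ 0)).mul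
    (const (h0 0) X)
  exact this.congr fun z _ ↦ by simp [h0]

theorem HasContLog.sub_div_sub {E X : Set ℂ} (hE : IsPreconnected E) (hX : IsCompact X)
    (hd : Disjoint E X) {p q : ℂ} (hp : p ∈ E) (hq : q ∈ E) :
    HasContLog (fun z ↦ (z - p) / (z - q)) X :=
  div_of_isPreconnected (F := fun t z ↦ z - t) hE hX (by fun_prop)
    (fun t ht z hz ↦ sub_ne_zero.2 fun h ↦ hd.le_bot ⟨ht, h ▸ hz⟩) hp hq

theorem HasContLog.eq_zero_of_sphere {p : ℂ} {R : ℝ} (hp : ‖p‖ < R) {c : ℤ}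
    (h : HasContLog (fun z ↦ (z - p) ^ c) (sphere 0 R)) : c = 0 := by
  have hR : 0 < R := (norm_nonneg p).trans_lt hp
  have hd : Disjoint (ball (0 : ℂ) R) (sphere 0 R) := sphere_disjoint_ball.symm
  have hdiv := sub_div_sub (convex_ball (0 : ℂ) R).isPreconnected (isCompact_sphere 0 R) hd
    (mem_ball_self hR) (mem_ball_zero_iff.2 hp)
  have hz : HasContLog (fun z : ℂ ↦ z ^ c) (sphere 0 R) := by
    refine (h.mul (hdiv.zpow c)).congr fun z hz ↦ ?_
    have hzp : z - p ≠ 0 := sub_ne_zero.2 fun hzp ↦ by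
      rw [hzp, mem_sphere_zero_iff_norm] at hz
      exact hp.ne hz
    simp only [sub_zero]
    rw [← mul_zpow, mul_div_cancel₀ _ hzp]
  obtain ⟨g, hg, hgexp⟩ := hz
  have hmem : ∀ θ : ℝ, circleMap 0 R θ ∈ sphere (0 : ℂ) R := fun θ ↦
    circleMap_mem_sphere 0 hR.le θ
  have hcomp : ContinuousOn (fun θ : ℝ ↦ g (circleMap 0 R θ)) univ :=
    hg.comp (continuous_circleMap 0 R).continuousOn fun θ _ ↦ hmem θ
  have := isPreconnected_univ.sub_eq_sub_of_exp_eq hcomp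
    (h := fun θ : ℝ ↦ c * (Complex.log R + θ * Complex.I)) (by fun_prop)
    (fun θ _ ↦ by
      rw [hgexp _ (hmem θ), Complex.exp_int_mul, Complex.exp_add,
        Complex.exp_log (by exact_mod_cast hR.ne'), circleMap_zero])
    (mem_univ (2 * Real.pi)) (mem_univ 0)
  have hper : circleMap 0 R (2 * Real.pi) = circleMap 0 R 0 := by
    simp [circleMap]
  rw [hper] at this
  have h2 : (c : ℂ) * (2 * Real.pi * Complex.I) = 0 := by
    push_cast at this
    linear_combination -this
  simpa [Real.pi_ne_zero] using h2

/-- If `p` lies in a bounded component `W` of the complement of `X`, then no nontrivial power of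
`z - p` agrees on `X` with an exponential up to a factor without zeros on the closure of `W`. -/
theorem HasContLog.eq_zero_of_isBounded_component {X : Set ℂ} (hX : IsCompact X) {p : ℂ}
    (hp : p ∉ X) (hb : Bornology.IsBounded (connectedComponentIn Xᶜ p)) {c : ℤ} {φ : ℂ → ℂ}
    (hφ : ContinuousOn φ (closure (connectedComponentIn Xᶜ p)))
    (hφ0 : ∀ z ∈ closure (connectedComponentIn Xᶜ p), φ z ≠ 0)
    (h : HasContLog (fun z ↦ (z - p) ^ c * φ z) X) : c = 0 := by
  classical
  set W := connectedComponentIn Xᶜ p with hW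
  have hWo : IsOpen W := hX.isClosed.isOpen_compl.connectedComponentIn
  have hpW : p ∈ W := mem_connectedComponentIn hp
  have hfr : frontier W ⊆ X := by
    intro z hz
    rw [hWo.frontier_eq] at hz
    by_contra hzX
    exact hz.2 (closure_connectedComponentIn_inter_subset Xᶜ p ⟨hz.1, hzX⟩)
  obtain ⟨g, hg, hgexp⟩ := h
  obtain ⟨G, hG, hGg⟩ := hX.isClosed.exists_continuous_extension hg
  set F := W.piecewise (fun z ↦ Complex.exp (G z) / φ z) (fun z ↦ (z - p) ^ c) with hFdef
  have hne : ∀ z ∈ Wᶜ, z - p ≠ 0 := fun z hz ↦ sub_ne_zero.2 fun h ↦ hz (h ▸ hpW)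
  have hF : Continuous F := by
    refine continuous_piecewise (fun z hz ↦ ?_) ?_ ?_
    · have hzX := hfr hz
      rw [hGg hzX, hgexp z hzX, mul_div_cancel_right₀ _ (hφ0 z (frontier_subset_closure hz))]
    · exact ContinuousOn.div (by fun_prop) hφ hφ0
    · rw [hWo.isClosed_compl.closure_eq]
      exact ContinuousOn.zpow₀ (by fun_prop) c fun z hz ↦ Or.inl (hne z hz)
  have hF0 : ∀ z, F z ≠ 0 := by
    intro z
    by_cases hz : z ∈ W
    · rw [hFdef, piecewise_eq_of_mem _ _ _ hz]
      exact div_ne_zero (Complex.exp_ne_zero _) (hφ0 z (subset_closure hz))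
    · rw [hFdef, piecewise_eq_of_notMem _ _ _ hz]
      exact zpow_ne_zero c (hne z hz)
  obtain ⟨R, hR⟩ := hb.subset_ball (0 : ℂ)
  refine eq_zero_of_sphere (mem_ball_zero_iff.1 (hR hpW))
    ((of_continuous hF hF0 (isCompact_sphere 0 R)).congr fun z hz ↦ ?_)
  exact piecewise_eq_of_notMem _ _ _ fun hzW ↦ sphere_disjoint_ball.le_bot ⟨hz, hR hzW⟩

end PlanarLogarithms

section Slabs

/-- The connected components of `K ∩ {s ≤ u ≤ t}` joining the two sides of the slab. -/
def crossingComponents {α : Type*} [TopologicalSpace α] (u : α → ℝ) (s t : ℝ) (K : Set α) :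
    Set (Set α) :=
  {R | (∃ z ∈ K ∩ {z | s ≤ u z ∧ u z ≤ t},
    R = connectedComponentIn (K ∩ {z | s ≤ u z ∧ u z ≤ t}) z) ∧
    (∃ l ∈ R, u l = s) ∧ ∃ r ∈ R, u r = t}

theorem exists_isClosed_cover_of_slab {α : Type*} [TopologicalSpace α] [T2Space α] {K : Set α}
    (hK : IsCompact K) (hKp : IsPreconnected K) {u : α → ℝ} (hu : Continuous u) {s t : ℝ}
    (hst : s < t) (hq : ∃ q ∈ K, t ≤ u q) :
    ∃ A B : Set α, IsClosed A ∧ IsClosed B ∧ A ⊆ K ∩ {z | u z ≤ t} ∧ B ⊆ K ∩ {z | s ≤ u z} ∧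
      K ⊆ A ∪ B ∧ A ∩ B ⊆ ⋃₀ crossingComponents u s t K ∧
      ∀ R ∈ crossingComponents u s t K, R ⊆ A ∩ B := by
  have hKt : IsCompact (K ∩ {z | u z ≤ t}) := hK.inter_right (isClosed_le hu continuous_const)
  have hKs : IsCompact (K ∩ {z | s ≤ u z}) := hK.inter_right (isClosed_le continuous_const hu)
  refine ⟨{z | z ∈ K ∩ {z | u z ≤ t} ∧
      (connectedComponentIn (K ∩ {z | u z ≤ t}) z ∩ {z | u z ≤ s}).Nonempty},
    {z | z ∈ K ∩ {z | s ≤ u z} ∧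
      (connectedComponentIn (K ∩ {z | s ≤ u z}) z ∩ {z | t ≤ u z}).Nonempty},
    hKt.isClosed_setOf_connectedComponentIn_inter_nonempty (isClosed_le hu continuous_const),
    hKs.isClosed_setOf_connectedComponentIn_inter_nonempty (isClosed_le continuous_const hu),
    fun z hz ↦ hz.1, fun z hz ↦ hz.1, ?_, ?_, ?_⟩
  · intro z hz
    rcases le_or_gt (u z) s with hzs | hzs
    · have hm : z ∈ K ∩ {z | u z ≤ t} := ⟨hz, hzs.trans hst.le⟩
      exact Or.inl ⟨hm, z, mem_connectedComponentIn hm, hzs⟩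
    rcases le_or_gt t (u z) with hzt | hzt
    · have hm : z ∈ K ∩ {z | s ≤ u z} := ⟨hz, hzs.le⟩
      exact Or.inr ⟨hm, z, mem_connectedComponentIn hm, hzt⟩
    have hm : z ∈ K ∩ {z | u z ≤ t} := ⟨hz, hzt.le⟩
    obtain ⟨w, hw, hwt⟩ := exists_mem_connectedComponentIn_le hKp hK hu hz hzt.le hq
    by_cases hne : (connectedComponentIn (K ∩ {z | u z ≤ t}) z ∩ {z | u z ≤ s}).Nonempty
    · exact Or.inl ⟨hm, hne⟩
    · refine Or.inr ⟨⟨hz, hzs.le⟩, w, ?_, hwt.ge⟩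
      refine isPreconnected_connectedComponentIn.subset_connectedComponentIn
        (mem_connectedComponentIn hm) (fun y hy ↦ ?_) hw
      exact ⟨(connectedComponentIn_subset _ _ hy).1, not_lt.1 fun (h : u y < s) ↦ hne ⟨y, hy, h.le⟩⟩
  · rintro z ⟨⟨hzt, p, hp, hps⟩, hzs, q, hq, hqt⟩
    have hmem : z ∈ K ∩ {z | s ≤ u z ∧ u z ≤ t} := ⟨hzt.1, hzs.2, hzt.2⟩
    obtain ⟨w, hw, hws⟩ := exists_mem_connectedComponentIn_ge isPreconnected_connectedComponentIn
      (hKt.of_isClosed_subset (hKt.isClosed.isClosed_connectedComponentIn z)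
        (connectedComponentIn_subset _ _)) hu (mem_connectedComponentIn hzt) hzs.2 ⟨p, hp, hps⟩
    obtain ⟨v, hv, hvt⟩ := exists_mem_connectedComponentIn_le isPreconnected_connectedComponentIn
      (hKs.of_isClosed_subset (hKs.isClosed.isClosed_connectedComponentIn z)
        (connectedComponentIn_subset _ _)) hu (mem_connectedComponentIn hzs) hzt.2 ⟨q, hq, hqt⟩
    refine ⟨_, ⟨⟨z, hmem, rfl⟩, ⟨w, connectedComponentIn_mono z ?_ hw, hws⟩,
      v, connectedComponentIn_mono z ?_ hv, hvt⟩, mem_connectedComponentIn hmem⟩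
    · rintro y ⟨hy, hys⟩
      have := connectedComponentIn_subset _ _ hy
      exact ⟨this.1, hys, this.2⟩
    · rintro y ⟨hy, hyt⟩
      have := connectedComponentIn_subset _ _ hy
      exact ⟨this.1, this.2, hyt⟩
  · rintro R ⟨⟨z, -, rfl⟩, ⟨l, hl, hls⟩, r, hr, hrt⟩ y hy
    have hyK := connectedComponentIn_subset _ _ hy
    have hmt : y ∈ K ∩ {z | u z ≤ t} := ⟨hyK.1, hyK.2.2⟩
    have hms : y ∈ K ∩ {z | s ≤ u z} := ⟨hyK.1, hyK.2.1⟩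
    rw [connectedComponentIn_eq hy] at hl hr
    refine ⟨⟨hmt, l,
        connectedComponentIn_mono y (inter_subset_inter_right K fun w hw ↦ hw.2) hl, hls.le⟩,
      hms, r, connectedComponentIn_mono y (inter_subset_inter_right K fun w hw ↦ hw.1) hr, hrt.ge⟩

theorem IsPeanoCompactum.finite_crossingComponents {K K₀ : Set ℂ} (hK : IsPeanoCompactum K) (x : ℂ)
    {s t : ℝ} (hst : s < t) (hsub : K₀ ∩ {z | s ≤ dist z x ∧ dist z x ≤ t} ⊆ K)
    (hK₀ : ∀ V ⊆ K, IsPreconnected V → (V ∩ K₀).Nonempty → V ⊆ K₀) :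
    (crossingComponents (dist · x) s t K₀).Finite := by
  obtain ⟨hKc, hKl, hKd⟩ := hK
  have hdx : Continuous (dist · x) := by fun_prop
  set Y := K₀ ∩ {z | s ≤ dist z x ∧ dist z x ≤ t}
  set m := (s + t) / 2 with hm
  have hex : ∀ R ∈ crossingComponents (dist · x) s t K₀, ∃ y ∈ R, dist y x = m := by
    rintro R ⟨⟨z, -, rfl⟩, ⟨l, hl, hls⟩, r, hr, hrt⟩
    exact isPreconnected_connectedComponentIn.intermediate_value hl hr hdx.continuousOn
      (⟨by linarith, by linarith⟩ : m ∈ Icc (dist l x) (dist r x))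
  choose! y hy hym using hex
  have hRy : ∀ R ∈ crossingComponents (dist · x) s t K₀, R = connectedComponentIn Y (y R) := by
    intro R hR
    have hyR := hy R hR
    obtain ⟨⟨z, -, rfl⟩, -⟩ := hR
    exact connectedComponentIn_eq hyR
  have hYK : ∀ R ∈ crossingComponents (dist · x) s t K₀, R ⊆ Y := by
    rintro R ⟨⟨z, -, rfl⟩, -⟩
    exact connectedComponentIn_subset _ _
  by_contra hinf
  have hmaps : MapsTo (fun R ↦ connectedComponentIn K (y R))
      (crossingComponents (dist · x) s t K₀)
      {Q : Set ℂ | (∃ x ∈ K, Q = connectedComponentIn K x) ∧ (t - s) / 2 < diam Q} := by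
    intro R hR
    have hyK : y R ∈ K := hsub (hYK R hR (hy R hR))
    refine ⟨⟨y R, hyK, rfl⟩, ?_⟩
    have hRK : R ⊆ connectedComponentIn K (y R) := by
      conv_lhs => rw [hRy R hR]
      exact connectedComponentIn_mono _ hsub
    obtain ⟨-, ⟨l, hl, hls⟩, r, hr, hrt⟩ := hR
    have h1 := dist_le_diam_of_mem (hKc.isBounded.subset (connectedComponentIn_subset K (y R)))
      (hRK hr) (hRK hl)
    have h2 := dist_triangle r l x
    simp only at hls hrt
    linarith
  obtain ⟨P, hPinf⟩ : ∃ P, (crossingComponents (dist · x) s t K₀ ∩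
      (fun R ↦ connectedComponentIn K (y R)) ⁻¹' {P}).Infinite := by
    by_contra! hcon
    exact hinf (Finite.of_finite_fibers _
      ((hKd ((t - s) / 2) (by linarith)).subset hmaps.image_subset) fun P _ ↦ hcon P)
  obtain ⟨R₀, hR₀, hR₀P⟩ := hPinf.nonempty
  have hyK₀ : y R₀ ∈ K := hsub (hYK R₀ hR₀ (hy R₀ hR₀))
  have hPK : P ⊆ K := hR₀P ▸ connectedComponentIn_subset _ _
  have hPc : IsCompact P := hKc.of_isClosed_subset
    (hR₀P ▸ hKc.isClosed.isClosed_connectedComponentIn _) hPK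
  have hPl : LocallyConnectedSpace P := by
    rw [← show connectedComponentIn K (y R₀) = P from hR₀P]
    exact hKl _ hyK₀
  set 𝓢 := crossingComponents (dist · x) s t K₀ ∩
      (fun R ↦ connectedComponentIn K (y R)) ⁻¹' {P} with h𝓢
  have hinj : InjOn y 𝓢 := fun R hR R' hR' h ↦ by rw [hRy R hR.1, hRy R' hR'.1, h]
  have hyP : y '' 𝓢 ⊆ P ∩ {z | dist z x = m} := by
    rintro _ ⟨R, hR, rfl⟩
    refine ⟨?_, hym R hR.1⟩
    rw [← show connectedComponentIn K (y R) = P from hR.2]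
    exact mem_connectedComponentIn (hsub (hYK R hR.1 (hy R hR.1)))
  obtain ⟨w, ⟨hwP, hwm⟩, hacc⟩ := (hPinf.image hinj).exists_accPt_of_subset_isCompact
    (hPc.inter_right (isClosed_eq hdx continuous_const)) hyP
  have hO : IsOpen {z : ℂ | s < dist z x ∧ dist z x < t} :=
    (isOpen_lt continuous_const hdx).inter (isOpen_lt hdx continuous_const)
  have hwO : w ∈ {z : ℂ | s < dist z x ∧ dist z x < t} := by
    have hwm' : dist w x = m := hwm
    constructor <;> linarith
  obtain ⟨V, hV, hVp, hVO⟩ := locallyConnectedSpace_iff_connected_subsets.1 hPl ⟨w, hwP⟩ _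
    (continuous_subtype_val.continuousAt.preimage_mem_nhds (hO.mem_nhds hwO))
  have hV' : (↑) '' V ∈ 𝓝[P] w := by
    rw [← map_nhds_subtype_val ⟨w, hwP⟩]
    exact image_mem_map hV
  obtain ⟨O, hO, hOV⟩ := mem_nhdsWithin_iff_exists_mem_nhds_inter.1 hV'
  obtain ⟨_, ⟨h₁O, R₁, h₁, rfl⟩, hne⟩ := accPt_iff_nhds.1 hacc O hO
  obtain ⟨_, ⟨⟨h₂O, hne'⟩, R₂, h₂, rfl⟩, -⟩ := accPt_iff_nhds.1 hacc (O ∩ {y R₁}ᶜ)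
    (inter_mem hO (isOpen_compl_singleton.mem_nhds hne.symm))
  have h₁V := hOV ⟨h₁O, (hyP ⟨R₁, h₁, rfl⟩).1⟩
  have h₂V := hOV ⟨h₂O, (hyP ⟨R₂, h₂, rfl⟩).1⟩
  have hVK : ((↑) '' V : Set ℂ) ⊆ K := (Subtype.coe_image_subset P V).trans hPK
  have hVc : IsPreconnected ((↑) '' V : Set ℂ) :=
    hVp.image _ continuous_subtype_val.continuousOn
  have hVK₀ := hK₀ _ hVK hVc ⟨y R₁, h₁V, (hYK R₁ h₁.1 (hy R₁ h₁.1)).1⟩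
  have hVY : ((↑) '' V : Set ℂ) ⊆ Y := by
    rintro z hz
    refine ⟨hVK₀ hz, ?_⟩
    obtain ⟨z, hzV, rfl⟩ := hz
    exact ⟨(hVO hzV).1.le, (hVO hzV).2.le⟩
  have hR : R₁ = R₂ := by
    rw [hRy R₁ h₁.1, hRy R₂ h₂.1]
    exact connectedComponentIn_eq (hVc.subset_connectedComponentIn h₁V hVY h₂V)
  exact hne' (hR ▸ rfl)

theorem HasContLog.exists_prod_zpow {ι α : Type*} [Fintype ι] [TopologicalSpace α]
    [Nonempty α] {A B : Set α}
    (hA : IsClosed A) (hB : IsClosed B) {F : ι → α → ℂ} (hFA : ∀ i, HasContLog (F i) A)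
    (hFB : ∀ i, HasContLog (F i) B) {𝓡 : Set (Set α)} (h𝓡 : 𝓡.Finite)
    (hcard : h𝓡.toFinset.card < Fintype.card ι) (hAB : A ∩ B ⊆ ⋃₀ 𝓡)
    (hR : ∀ R ∈ 𝓡, R ⊆ A ∩ B ∧ IsConnected R) :
    ∃ c : ι → ℤ, (∃ i, c i ≠ 0) ∧ HasContLog (fun z ↦ ∏ i, F i z ^ c i) (A ∪ B) := by
  choose a ha haF using hFA
  choose b hb hbF using hFB
  choose! y hy using fun R hR' ↦ (hR R hR').2.nonempty
  have hint : ∀ i, ∀ R : h𝓡.toFinset, ∃ n : ℤ,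
      a i (y R) = b i (y R) + n * (2 * Real.pi * Complex.I) := by
    intro i R
    have hR𝓡 := h𝓡.mem_toFinset.1 R.2
    have hyAB := (hR R hR𝓡).1 (hy R hR𝓡)
    rw [← Complex.exp_eq_exp_iff_exists_int, haF i _ hyAB.1, hbF i _ hyAB.2]
  choose d hd using hint
  have hdep : ¬ LinearIndependent ℤ d := fun hli ↦ by
    have := hli.fintype_card_le_finrank
    rw [Module.finrank_fintype_fun_eq_card, Fintype.card_coe] at this
    omega
  obtain ⟨c, hc, hc0⟩ := Fintype.not_linearIndependent_iff.1 hdep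
  refine ⟨c, hc0, union_of_eqOn (g := fun z ↦ ∑ i, c i * a i z) (g' := fun z ↦ ∑ i, c i * b i z)
    hA hB (by fun_prop) (by fun_prop) (fun z hz ↦ ?_) (fun z hz ↦ ?_) fun z hz ↦ ?_⟩
  · rw [Complex.exp_sum]
    exact Finset.prod_congr rfl fun i _ ↦ by rw [Complex.exp_int_mul, haF i z hz]
  · rw [Complex.exp_sum]
    exact Finset.prod_congr rfl fun i _ ↦ by rw [Complex.exp_int_mul, hbF i z hz]
  · obtain ⟨R, hR𝓡, hzR⟩ := hAB hz
    have hyR := hy R hR𝓡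
    have hRAB := (hR R hR𝓡).1
    have hconst : ∀ i, a i z - b i z = a i (y R) - b i (y R) := fun i ↦
      (hR R hR𝓡).2.isPreconnected.sub_eq_sub_of_exp_eq
        ((ha i).mono (hRAB.trans inter_subset_left)) ((hb i).mono (hRAB.trans inter_subset_right))
        (fun w hw ↦ by rw [haF i w (hRAB hw).1, hbF i w (hRAB hw).2]) hzR hyR
    have hsum := congrFun hc ⟨R, h𝓡.mem_toFinset.2 hR𝓡⟩
    simp only [Finset.sum_apply, Pi.smul_apply, smul_eq_mul, Pi.zero_apply] at hsum
    have hsum' : ∑ i, (c i : ℂ) * d i ⟨R, h𝓡.mem_toFinset.2 hR𝓡⟩ = 0 := by exact_mod_cast hsum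
    refine sub_eq_zero.1 ?_
    rw [← Finset.sum_sub_distrib]
    calc ∑ i, (c i * a i z - c i * b i z)
        = ∑ i, (c i * d i ⟨R, h𝓡.mem_toFinset.2 hR𝓡⟩ : ℂ) * (2 * Real.pi * Complex.I) := by
          refine Finset.sum_congr rfl fun i _ ↦ ?_
          rw [← mul_sub, hconst i, hd i ⟨R, h𝓡.mem_toFinset.2 hR𝓡⟩]
          ring
      _ = 0 := by rw [← Finset.sum_mul, hsum', zero_mul]

end Slabs

section PropertySOfPeano

theorem isConnected_of_mem_crossingComponents {α : Type*} [TopologicalSpace α] {u : α → ℝ}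
    {s t : ℝ} {K R : Set α} (hR : R ∈ crossingComponents u s t K) : IsConnected R := by
  obtain ⟨⟨z, hz, rfl⟩, -⟩ := hR
  exact isConnected_connectedComponentIn_iff.2 hz

theorem IsPreconnected.subset_of_disjoint_frontier {α : Type*} [TopologicalSpace α] {W U : Set α}
    (hW : IsPreconnected W) (hU : IsOpen U) (hWU : (W ∩ U).Nonempty)
    (hd : Disjoint W (frontier U)) : W ⊆ U := by
  refine hW.subset_of_closure_inter_subset hU hWU fun z hz ↦ ?_
  by_contra hzU
  exact hd.le_bot ⟨hz.2, hU.frontier_eq ▸ ⟨hz.1, hzU⟩⟩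

theorem HasContLog.sub_closedBall {x q : ℂ} {t : ℝ} (hq : t < dist q x) :
    HasContLog (fun z ↦ z - q) (closedBall x t) := by
  rcases lt_or_ge t 0 with ht | ht
  · rw [closedBall_eq_empty.2 ht]
    exact ⟨fun _ ↦ 0, continuousOn_empty _, by simp⟩
  have hxq : x - q ≠ 0 := sub_ne_zero.2 fun h ↦ by
    rw [h, dist_self] at hq
    exact hq.not_ge ht
  have hlog : HasContLog (fun z ↦ (z - q) / (x - q)) (closedBall x t) := by
    refine of_norm_sub_one_lt (by fun_prop) fun z hz ↦ ?_
    have : (z - q) / (x - q) - 1 = (z - x) / (x - q) := by field_simp; ring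
    rw [this, norm_div, div_lt_one (norm_pos_iff.2 hxq), ← dist_eq_norm, ← dist_eq_norm,
      dist_comm x q]
    exact (mem_closedBall.1 hz).trans_lt hq
  exact (hlog.mul (const hxq _)).congr fun z _ ↦ div_mul_cancel₀ _ hxq

theorem component_eq_of_subset_closedBall {Ω : Set ℂ} (hΩ : IsOpen Ω) (hΩc : IsPreconnected Ω)
    {x p : ℂ} {t r : ℝ} (htr : t < r) (hp : p ∈ Ω ∩ ball x r)
    (h : connectedComponentIn (Ω ∩ ball x r) p ⊆ closedBall x t) :
    connectedComponentIn (Ω ∩ ball x r) p = Ω := by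
  refine ((connectedComponentIn_subset _ _).trans inter_subset_left).antisymm ?_
  refine hΩc.subset_of_closure_inter_subset (hΩ.inter isOpen_ball).connectedComponentIn
    ⟨p, hp.1, mem_connectedComponentIn hp⟩ fun z hz ↦ ?_
  refine closure_connectedComponentIn_inter_subset _ _ ⟨hz.1, hz.2, ?_⟩
  exact closedBall_subset_ball htr (closure_minimal h isClosed_closedBall hz.1)

/-- Only finitely many components of `Ω ∩ ball x r` meet a smaller concentric ball. -/
theorem IsPeanoCompactum.finite_components_of_ball {Ω : Set ℂ} (hΩ : IsOpen Ω)
    (hΩc : IsPreconnected Ω) (hK : IsPeanoCompactum (frontier Ω)) (x : ℂ) {s t r : ℝ} (hs : 0 < s)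
    (hst : s < t) (htr : t < r) :
    {U | ∃ p ∈ Ω ∩ ball x s, U = connectedComponentIn (Ω ∩ ball x r) p}.Finite := by
  by_contra hinf
  have hballs : ball x s ⊆ ball x r := ball_subset_ball (hst.trans htr).le
  have hfar : ∀ p ∈ Ω ∩ ball x s, ∃ q ∈ connectedComponentIn (Ω ∩ ball x r) p, t < dist q x := by
    intro p hp
    by_contra! hcon
    have hpΩ := component_eq_of_subset_closedBall hΩ hΩc htr ⟨hp.1, hballs hp.2⟩ hcon
    refine hinf ((finite_singleton Ω).subset ?_)
    rintro U ⟨p', hp', rfl⟩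
    have hpp : p' ∈ connectedComponentIn (Ω ∩ ball x r) p := hpΩ.symm ▸ hp'.1
    rw [mem_singleton_iff, ← connectedComponentIn_eq hpp, hpΩ]
  set S := sphere x r with hS
  set X := frontier Ω ∪ S with hX
  have hXc : IsCompact X := hK.1.union (isCompact_sphere x r)
  have hr : 0 < r := hs.trans (hst.trans htr)
  obtain ⟨y₀, hy₀⟩ : S.Nonempty := NormedSpace.sphere_nonempty.2 hr.le
  have hSp : IsPreconnected S := isPreconnected_sphere (by simp [Complex.rank_real_complex]) x r
  set K₀ := connectedComponentIn X y₀ with hK₀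
  have hSK₀ : S ⊆ K₀ := hSp.subset_connectedComponentIn hy₀ subset_union_right
  have hK₀X : K₀ ⊆ X := connectedComponentIn_subset _ _
  have hK₀c : IsCompact K₀ :=
    hXc.of_isClosed_subset (hXc.isClosed.isClosed_connectedComponentIn _) hK₀X
  have hdx : Continuous (dist · x) := by fun_prop
  obtain ⟨A, B, hA, hB, hAt, hBs, hAB, hABR, hRAB⟩ := exists_isClosed_cover_of_slab hK₀c
    isPreconnected_connectedComponentIn hdx hst ⟨y₀, hSK₀ hy₀, (htr.trans_eq hy₀.symm).le⟩
  have h𝓡 : (crossingComponents (dist · x) s t K₀).Finite := by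
    refine hK.finite_crossingComponents x hst ?_ ?_
    · rintro z ⟨hz, -, hzt⟩
      exact (hK₀X hz).resolve_right fun hzS ↦ (hzt.trans_lt htr).ne hzS
    · rintro V hV hVp ⟨z, hzV, hz⟩
      exact subset_connectedComponentIn_of_mem hVp (hV.trans subset_union_left) hzV hz
  set f := Set.Infinite.natEmbedding _ hinf
  choose p hp hpU using fun n ↦ (f n).2
  have hUne : ∀ n m, n ≠ m →
      connectedComponentIn (Ω ∩ ball x r) (p n) ≠ connectedComponentIn (Ω ∩ ball x r) (p m) := by
    intro n m hnm h
    rw [← hpU, ← hpU] at h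
    exact hnm (f.injective (Subtype.ext h))
  have hp' : ∀ n, p n ∈ Ω ∩ ball x r := fun n ↦ ⟨(hp n).1, hballs (hp n).2⟩
  have hdisj : Disjoint (Ω ∩ ball x r) X := by
    refine disjoint_left.2 fun z hz hzX ↦ ?_
    rcases hzX with hzX | hzX
    · exact (hΩ.frontier_eq ▸ hzX : z ∈ closure Ω \ Ω).2 hz.1
    · exact sphere_disjoint_ball.le_bot ⟨hzX, hz.2⟩
  have hpX : ∀ n, ∀ z ∈ X, z - p n ≠ 0 := fun n z hz ↦
    sub_ne_zero.2 fun h ↦ hdisj.le_bot ⟨hp' n, h ▸ hz⟩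
  set F : Fin (h𝓡.toFinset.card + 1) → ℂ → ℂ :=
    fun i z ↦ (z - p (i + 1)) / (z - p 0) with hF
  have hAX : A ⊆ X := hAt.trans (inter_subset_left.trans hK₀X)
  have hBX : B ⊆ X := hBs.trans (inter_subset_left.trans hK₀X)
  have hlogA : ∀ n, HasContLog (fun z ↦ z - p n) A := by
    intro n
    obtain ⟨q, hq, hqt⟩ := hfar (p n) (hp n)
    have h1 := (HasContLog.sub_div_sub isPreconnected_connectedComponentIn hXc
      (hdisj.mono_left (connectedComponentIn_subset _ _)) (mem_connectedComponentIn (hp' n))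
      hq).mono hAX
    refine (h1.mul ((HasContLog.sub_closedBall hqt).mono fun z hz ↦ (hAt hz).2)).congr
      fun z hz ↦ div_mul_cancel₀ _ (sub_ne_zero.2 fun h ↦ ?_)
    exact hqt.not_ge (h ▸ (hAt hz).2)
  have hlogB : ∀ i, HasContLog (F i) B := by
    refine fun i ↦ HasContLog.sub_div_sub (convex_ball x s).isPreconnected
      (hXc.of_isClosed_subset hB hBX) (disjoint_left.2 fun z hz hzB ↦ ?_) (hp _).2 (hp _).2
    exact (mem_ball.1 hz).not_ge (hBs hzB).2
  obtain ⟨c, ⟨m, hm⟩, hc⟩ := HasContLog.exists_prod_zpow (F := F) hA hB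
    (fun i ↦ (hlogA (i + 1)).div (hlogA 0)) hlogB h𝓡 (by simp) hABR
    fun R hR ↦ ⟨hRAB R hR, isConnected_of_mem_crossingComponents hR⟩
  have hFX : ∀ i, ContinuousOn (F i) X := fun i ↦
    ContinuousOn.div (by fun_prop) (by fun_prop) (hpX 0)
  have hFX0 : ∀ i, ∀ z ∈ X, F i z ≠ 0 := fun i z hz ↦ div_ne_zero (hpX _ z hz) (hpX 0 z hz)
  have hlogX : HasContLog (fun z ↦ ∏ i, F i z ^ c i) X := by
    refine HasContLog.of_connectedComponentIn hXc
      (continuousOn_finsetProd _ fun i _ ↦ (hFX i).zpow₀ _ fun z hz ↦ Or.inl (hFX0 i z hz))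
      fun y hy ↦ ?_
    by_cases hyK : y ∈ K₀
    · rw [← connectedComponentIn_eq hyK]
      exact hc.mono hAB
    · refine HasContLog.prod _ fun i _ ↦ HasContLog.zpow ?_ _
      refine HasContLog.sub_div_sub hΩc (hXc.of_isClosed_subset
        (hXc.isClosed.isClosed_connectedComponentIn _) (connectedComponentIn_subset _ _))
        (disjoint_left.2 fun z hz hzy ↦ ?_) (hp _).1 (hp _).1
      rcases connectedComponentIn_subset _ _ hzy with hzf | hzS
      · exact (hΩ.frontier_eq ▸ hzf : z ∈ closure Ω \ Ω).2 hz
      · refine hyK ?_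
        rw [hK₀, connectedComponentIn_eq (hSK₀ hzS), ← connectedComponentIn_eq hzy]
        exact mem_connectedComponentIn hy
  have hpmX : p (m + 1) ∉ X := fun h ↦ hdisj.le_bot ⟨hp' _, h⟩
  set W := connectedComponentIn Xᶜ (p (m + 1)) with hW
  have hpW : p (m + 1) ∈ W := mem_connectedComponentIn hpmX
  have hWX : Disjoint W X := disjoint_left.2 fun z hz ↦ connectedComponentIn_subset _ _ hz
  have hWΩ : W ⊆ Ω ∩ ball x r := subset_inter
    (isPreconnected_connectedComponentIn.subset_of_disjoint_frontier hΩ ⟨_, hpW, (hp' _).1⟩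
      (hWX.mono_right subset_union_left))
    (isPreconnected_connectedComponentIn.subset_of_disjoint_frontier isOpen_ball
      ⟨_, hpW, (hp' _).2⟩
      (hWX.mono_right (by rw [frontier_ball x hr.ne']; exact subset_union_right)))
  have hWU : W ⊆ connectedComponentIn (Ω ∩ ball x r) (p (m + 1)) :=
    isPreconnected_connectedComponentIn.subset_connectedComponentIn hpW hWΩ
  have hpcl : ∀ n : ℕ, n ≠ m + 1 → ∀ z ∈ closure W, z - p n ≠ 0 := by
    intro n hn z hz
    refine sub_ne_zero.2 fun h ↦ ?_
    obtain ⟨w, hw, hwW⟩ := mem_closure_iff.1 hz (connectedComponentIn (Ω ∩ ball x r) (p n))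
      (hΩ.inter isOpen_ball).connectedComponentIn
      (by rw [h]; exact mem_connectedComponentIn (hp' n))
    exact hUne n (m + 1) hn ((connectedComponentIn_eq hw).trans
      (connectedComponentIn_eq (hWU hwW)).symm)
  have hpcl' : ∀ i, i ≠ m → ∀ z ∈ closure W, z - p (i + 1) ≠ 0 := fun i hi ↦
    hpcl _ fun h ↦ hi (Fin.ext (by omega))
  have hp0 := hpcl 0 (by omega)
  have hFcl : ∀ i, i ≠ m → ∀ z ∈ closure W, F i z ≠ 0 := fun i hi z hz ↦
    div_ne_zero (hpcl' i hi z hz) (hp0 z hz)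
  refine hm (HasContLog.eq_zero_of_isBounded_component hXc hpmX
    (isBounded_ball.subset (hWΩ.trans inter_subset_right))
    (φ := fun z ↦ (z - p 0) ^ (-c m) * ∏ i ∈ Finset.univ.erase m, F i z ^ c i) ?_ ?_
    (hlogX.congr fun z hz ↦ ?_))
  · refine ContinuousOn.mul (ContinuousOn.zpow₀ (by fun_prop) _ fun z hz ↦ Or.inl (hp0 z hz))
      (continuousOn_finsetProd _ fun i hi ↦ ?_)
    have him := Finset.ne_of_mem_erase hi
    exact ContinuousOn.zpow₀ (ContinuousOn.div (by fun_prop) (by fun_prop) hp0) _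
      fun z hz ↦ Or.inl (hFcl i him z hz)
  · exact fun z hz ↦ mul_ne_zero (zpow_ne_zero _ (hp0 z hz)) (Finset.prod_ne_zero_iff.2
      fun i hi ↦ zpow_ne_zero _ (hFcl i (Finset.ne_of_mem_erase hi) z hz))
  · simp only [← Finset.mul_prod_erase _ _ (Finset.mem_univ m), ← mul_assoc]
    congr 1
    simp only [hF, div_zpow, zpow_neg, ← div_eq_mul_inv]

theorem IsPeanoCompactum.propertyS {Ω : Set ℂ} (hΩ : IsOpen Ω) (hΩc : IsPreconnected Ω)
    (hb : Bornology.IsBounded Ω) (hK : IsPeanoCompactum (frontier Ω)) : PropertyS Ω := by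
  intro ε hε
  obtain ⟨T, hT, hΩT⟩ := Metric.totallyBounded_iff.1
    (hb.isCompact_closure.totallyBounded.subset subset_closure) (ε / 6) (by positivity)
  have hfin : (⋃ x ∈ T, {U | ∃ p ∈ Ω ∩ ball x (ε / 6),
      U = connectedComponentIn (Ω ∩ ball x (ε / 3)) p}).Finite :=
    hT.biUnion fun x _ ↦ hK.finite_components_of_ball hΩ hΩc x (t := ε / 4) (by positivity)
      (by linarith) (by linarith)
  refine ⟨hfin.toFinset.card, fun i ↦ (hfin.toFinset.equivFin.symm i : Set ℂ), fun i ↦ ?_, ?_⟩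
  · obtain ⟨x, -, p, hp, hU⟩ := mem_iUnion₂.1
      (hfin.mem_toFinset.1 (hfin.toFinset.equivFin.symm i).2)
    simp only [hU]
    refine ⟨isConnected_connectedComponentIn_iff.2
      ⟨hp.1, ball_subset_ball (by linarith) hp.2⟩, ?_⟩
    calc _ ≤ diam (ball x (ε / 3)) := diam_mono
          ((connectedComponentIn_subset _ _).trans inter_subset_right) isBounded_ball
      _ ≤ 2 * (ε / 3) := diam_ball (by positivity)
      _ < ε := by linarith
  · refine subset_antisymm (iUnion_subset fun i ↦ ?_) fun z hz ↦ ?_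
    · obtain ⟨x, -, p, -, hU⟩ := mem_iUnion₂.1
        (hfin.mem_toFinset.1 (hfin.toFinset.equivFin.symm i).2)
      rw [hU]
      exact (connectedComponentIn_subset _ _).trans inter_subset_left
    · obtain ⟨x, hx, hzx⟩ := mem_iUnion₂.1 (hΩT hz)
      have hmem : connectedComponentIn (Ω ∩ ball x (ε / 3)) z ∈ hfin.toFinset :=
        hfin.mem_toFinset.2 (mem_iUnion₂.2 ⟨x, hx, z, ⟨hz, hzx⟩, rfl⟩)
      refine mem_iUnion.2 ⟨hfin.toFinset.equivFin ⟨_, hmem⟩, ?_⟩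
      rw [Equiv.symm_apply_apply]
      exact mem_connectedComponentIn ⟨hz, ball_subset_ball (by linarith) hzx⟩

end PropertySOfPeano

/-- A bounded domain has property S iff its boundary is a Peano compactum. -/
theorem stmt_6 (Ω : Set ℂ) (hΩ : IsPlanarDomain Ω) (hb : Bornology.IsBounded Ω) :
    PropertyS Ω ↔ IsPeanoCompactum (frontier Ω) :=
  ⟨fun h ↦ h.isPeanoCompactum_frontier hΩ.2.1 hb,
    fun h ↦ h.propertyS hΩ.2.1 hΩ.2.2.isPreconnected hb⟩
end
end

section
/- Every generalized Jordan domain is simply connected at the boundary; that is, if D ⊆ ℂ is a generalized Jordan domain, then for every x ∈ ∂D and every r > 0 there is an open set U ⊆ ℂ with x ∈ U ⊆ {z : |z − x| < r} such that U ∩ D is connected. -/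
open Set Metric Filter MeasureTheory Topology

noncomputable section

/-- Two continuous logarithms of the same function on a preconnected set differ by a constant. -/
theorem IsPreconnected.sub_eq_sub_of_exp_eq_s7 {X : Type*} [TopologicalSpace X] {S : Set X}
    (hS : IsPreconnected S) {f g : X → ℂ} (hf : ContinuousOn f S) (hg : ContinuousOn g S)
    (h : ∀ z ∈ S, Complex.exp (f z) = Complex.exp (g z)) {z w : X} (hz : z ∈ S) (hw : w ∈ S) :
    f z - g z = f w - g w := by
  have key : ∀ a ∈ S, Complex.exp (f a - g a) = 1 := fun a ha => by
    rw [Complex.exp_sub, h a ha, div_self (Complex.exp_ne_zero _)]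
  exact Complex.isCoveringMap_exp.isSeparatedMap.constOn_of_comp
    Complex.isCoveringMap_exp.isLocalHomeomorph.isLocallyInjective hS (hf.sub hg)
    (fun a ha b hb => Subtype.ext ((key a ha).trans (key b hb).symm)) hz hw

/-- The function `z ↦ z - a` near infinity has no continuous nonvanishing extension to `ℂ`. -/
theorem exists_eq_zero_of_eq_sub_of_le_norm {G : ℂ → ℂ} (hG : Continuous G) {a : ℂ} {R : ℝ}
    (hR : 0 < R) (h : ∀ z, R ≤ ‖z - a‖ → G z = z - a) : ∃ z, G z = 0 := by
  by_contra! hne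
  obtain ⟨H, ⟨-, hH⟩, -⟩ := Complex.isCoveringMapOn_exp.existsUnique_continuousMap_lifts
    ⟨G, hG⟩ (Complex.exp_log (hne 0)) hne
  have hH : ∀ z, Complex.exp (H z) = G z := fun z => congrFun hH z
  have := isPreconnected_univ.sub_eq_sub_of_exp_eq_s7 (S := (univ : Set ℝ))
    (f := fun θ : ℝ => H (a + R * Complex.exp (θ * Complex.I)))
    (g := fun θ : ℝ => (Real.log R : ℂ) + θ * Complex.I)
    (by fun_prop) (by fun_prop) (fun θ _ => by
      rw [hH, h _ (by simp [Complex.norm_exp_ofReal_mul_I, abs_of_pos hR]), Complex.exp_add,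
        ← Complex.ofReal_exp, Real.exp_log hR]
      ring) (mem_univ (2 * Real.pi)) (mem_univ 0)
  simp [Complex.exp_two_pi_mul_I, Real.pi_ne_zero] at this

/-- If `(z - a) / (z - b)` has a continuous logarithm on a closed set `X`, then `X` does not
separate `a` from `b`. -/
theorem mem_connectedComponentIn_of_exists_log {X : Set ℂ} (hX : IsClosed X) {a b : ℂ}
    (ha : a ∉ X) (hb : b ∉ X) (hbdd : Bornology.IsBounded (connectedComponentIn Xᶜ a))
    {h : ℂ → ℂ} (hc : ContinuousOn h X)
    (hh : ∀ z ∈ X, Complex.exp (h z) = (z - a) / (z - b)) :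
    b ∈ connectedComponentIn Xᶜ a := by
  classical
  by_contra hbU
  set U := connectedComponentIn Xᶜ a with hU
  have hUo : IsOpen U := hX.isOpen_compl.connectedComponentIn
  have haU : a ∈ U := mem_connectedComponentIn ha
  have hfr : frontier U ⊆ X := by
    intro z hz
    by_contra hzX
    have hzo : IsOpen (connectedComponentIn Xᶜ z) := hX.isOpen_compl.connectedComponentIn
    obtain ⟨w, hw1, hw2⟩ := mem_closure_iff.1 (frontier_subset_closure hz) _ hzo
      (mem_connectedComponentIn hzX)
    have e : connectedComponentIn Xᶜ a = connectedComponentIn Xᶜ z :=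
      (connectedComponentIn_eq hw2).trans (connectedComponentIn_eq hw1).symm
    have hzU : z ∈ U := by rw [hU, e]; exact mem_connectedComponentIn hzX
    exact (hUo.frontier_eq ▸ hz).2 hzU
  obtain ⟨g, hg⟩ := ContinuousMap.exists_restrict_eq hX ⟨_, hc.domRestrict⟩
  have hg : ∀ z ∈ X, g z = h z := fun z hz => DFunLike.congr_fun hg ⟨z, hz⟩
  have hbX : ∀ z ∈ X, z - b ≠ 0 := fun z hz e => hb (sub_eq_zero.1 e ▸ hz)
  have hcont : Continuous fun z => if z ∈ U then Complex.exp (g z) * (z - b) else z - a := by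
    refine Continuous.if (fun z hz => ?_) (by fun_prop) (by fun_prop)
    have hzX := hfr hz
    rw [hg z hzX, hh z hzX, div_mul_cancel₀ _ (hbX z hzX)]
  obtain ⟨R, hR, hUR⟩ := hbdd.subset_ball_lt 0 a
  obtain ⟨z, hz⟩ := exists_eq_zero_of_eq_sub_of_le_norm hcont hR (a := a) fun z hz =>
    if_neg fun hzU => (mem_ball_iff_norm.1 (hUR hzU)).not_ge hz
  split_ifs at hz with hzU
  · rcases mul_eq_zero.1 hz with hz | hz
    · exact Complex.exp_ne_zero _ hz
    · exact hbU (sub_eq_zero.1 hz ▸ hzU)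
  · exact hzU (sub_eq_zero.1 hz ▸ haU)

/-- `(z - a) / (z - b)` has the principal logarithm as a continuous logarithm on the complement
of a disk around `b` containing `a`. -/
theorem continuousOn_log_sub_div_sub {S : Set ℂ} {a b : ℂ}
    (h : ∀ z ∈ S, dist a b < dist z b) :
    ContinuousOn (fun z => Complex.log ((z - a) / (z - b))) S ∧
      ∀ z ∈ S, Complex.exp (Complex.log ((z - a) / (z - b))) = (z - a) / (z - b) := by
  have hb : ∀ z ∈ S, z - b ≠ 0 := fun z hz e => by
    have := h z hz
    rw [sub_eq_zero.1 e, dist_self] at this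
    exact this.not_ge dist_nonneg
  have hs : ∀ z ∈ S, (z - a) / (z - b) ∈ Complex.slitPlane := fun z hz => by
    have : (z - a) / (z - b) = 1 + (b - a) / (z - b) := by
      field_simp [hb z hz]; ring
    rw [this]
    refine Complex.mem_slitPlane_of_norm_lt_one ?_
    rw [norm_div, div_lt_one (norm_pos_iff.2 (hb z hz)), ← dist_eq_norm, ← dist_eq_norm, dist_comm]
    exact h z hz
  refine ⟨ContinuousOn.clog (ContinuousOn.div (by fun_prop) (by fun_prop) hb) hs, fun z hz => ?_⟩
  exact Complex.exp_log (Complex.slitPlane_ne_zero (hs z hz))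

/-- If `a` and `b` lie in a connected open set `D` missing `K`, then `(z - a) / (z - b)` has a
continuous logarithm on `K`. -/
theorem exists_log_sub_div_sub_of_isPreconnected {D K : Set ℂ} (hDo : IsOpen D)
    (hD : IsPreconnected D) (hDK : Disjoint D K) {a b : ℂ} (ha : a ∈ D) (hb : b ∈ D) :
    ∃ f : ℂ → ℂ, ContinuousOn f K ∧ ∀ z ∈ K, Complex.exp (f z) = (z - a) / (z - b) := by
  have hne : ∀ c ∈ D, ∀ z ∈ K, z - c ≠ 0 := fun c hc z hz e =>
    hDK.notMem_of_mem_left hc (sub_eq_zero.1 e ▸ hz)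
  refine hD.induction₂ (fun a b => ∃ f : ℂ → ℂ, ContinuousOn f K ∧
    ∀ z ∈ K, Complex.exp (f z) = (z - a) / (z - b)) (fun c hc => ?_)
    (fun a b c ha hb hc => ?_) (fun a b ha hb => ?_) ha hb
  · obtain ⟨ε, hε, hball⟩ := Metric.isOpen_iff.1 hDo c hc
    filter_upwards [nhdsWithin_le_nhds (ball_mem_nhds c (half_pos hε))] with d hd
    rw [mem_ball] at hd
    obtain ⟨h1, h2⟩ := continuousOn_log_sub_div_sub (S := K) (a := c) (b := d) fun z hz => by
      have hz' : ε ≤ dist z c := by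
        by_contra! hlt
        exact hDK.notMem_of_mem_left (hball hlt) hz
      have := dist_triangle z d c
      rw [dist_comm c d]
      linarith
    exact ⟨_, h1, h2⟩
  · rintro ⟨f, hf, hf'⟩ ⟨g, hg, hg'⟩
    refine ⟨fun z => f z + g z, hf.add hg, fun z hz => ?_⟩
    rw [Complex.exp_add, hf' z hz, hg' z hz, div_mul_div_cancel₀ (hne b hb z hz)]
  · rintro ⟨f, hf, hf'⟩
    exact ⟨fun z => -f z, hf.neg, fun z hz => by rw [Complex.exp_neg, hf' z hz, inv_div]⟩

/-- In a compact space, sections that exist on a clopen neighbourhood of each point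
glue to a global continuous section. -/
theorem exists_continuous_of_forall_exists_isClopen {X Y : Type*} [TopologicalSpace X]
    [CompactSpace X] [TopologicalSpace Y] {P : X → Y → Prop} [Nonempty Y]
    (h : ∀ x, ∃ N : Set X, IsClopen N ∧ x ∈ N ∧
      ∃ f : X → Y, ContinuousOn f N ∧ ∀ z ∈ N, P z (f z)) :
    ∃ f : X → Y, Continuous f ∧ ∀ z, P z (f z) := by
  classical
  obtain ⟨N, -, hN, f, hf, hfP⟩ := isCompact_univ.induction_on
    (p := fun S => ∃ N : Set X, IsClopen N ∧ S ⊆ N ∧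
      ∃ f : X → Y, ContinuousOn f N ∧ ∀ z ∈ N, P z (f z))
    ⟨∅, isClopen_empty, subset_rfl, fun _ => Classical.arbitrary Y, by simp, by simp⟩
    (fun S T hST ⟨N, hN, hTN, hf⟩ => ⟨N, hN, hST.trans hTN, hf⟩)
    (fun S T ⟨N, hN, hSN, f, hf, hfP⟩ ⟨M, hM, hTM, g, hg, hgP⟩ => by
      refine ⟨N ∪ M, hN.union hM, union_subset_union hSN hTM, N.piecewise f g, ?_, fun z hz => ?_⟩
      · refine ContinuousOn.piecewise (by simp [hN.frontier_eq]) ?_ ?_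
        · rw [hN.isClosed.closure_eq]
          exact hf.mono inter_subset_right
        · rw [hN.compl.isClosed.closure_eq]
          exact hg.mono fun z hz => hz.1.resolve_left hz.2
      · by_cases hzN : z ∈ N
        · simpa [hzN] using hfP z hzN
        · simpa [hzN] using hgP z (hz.resolve_left hzN))
    (fun x _ => by
      obtain ⟨N, hN, hxN, hf⟩ := h x
      exact ⟨N, nhdsWithin_le_nhds (hN.isOpen.mem_nhds hxN), N, hN, subset_rfl, hf⟩)
  exact ⟨f, continuousOn_univ.1 (hf.mono hN), fun z => hfP z (hN trivial)⟩

/-- In a compact Hausdorff space, every open neighbourhood of a connected component contains a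
clopen neighbourhood of it. -/
theorem exists_isClopen_of_connectedComponent_subset {X : Type*} [TopologicalSpace X]
    [CompactSpace X] [T2Space X] {x : X} {V : Set X} (hV : IsOpen V)
    (h : connectedComponent x ⊆ V) : ∃ N : Set X, IsClopen N ∧ x ∈ N ∧ N ⊆ V := by
  rw [connectedComponent_eq_iInter_isClopen] at h
  obtain ⟨t, ht⟩ := hV.isClosed_compl.isCompact.elim_finite_subfamily_closed
    (fun s : {s : Set X // IsClopen s ∧ x ∈ s} => (s : Set X)) (fun s => s.2.1.1)
    (disjoint_compl_left_iff_subset.2 h).inter_eq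
  exact ⟨⋂ s ∈ t, s, isClopen_biInter_finset fun s _ => s.2.1, mem_iInter₂.2 fun s _ => s.2.2,
    disjoint_compl_left_iff_subset.1 (disjoint_iff_inter_eq_empty.2 ht)⟩

/-- Given a point `x` of a Jordan curve, a subarc missing `x` contains everything outside a given
disk around `x`. -/
theorem IsJordanCurve.exists_isPreconnected_notMem {Q : Set ℂ} (hQ : IsJordanCurve Q) {x : ℂ}
    (hx : x ∈ Q) {r : ℝ} (hr : 0 < r) :
    ∃ A ⊆ Q, IsCompact A ∧ IsPreconnected A ∧ x ∉ A ∧ Q \ ball x r ⊆ A := by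
  obtain ⟨e⟩ := hQ
  set w : sphere (0 : ℂ) 1 := e ⟨x, hx⟩ with hw
  have hw1 : ‖(w : ℂ)‖ = 1 := mem_sphere_zero_iff_norm.1 w.2
  have hw0 : (w : ℂ) ≠ 0 := norm_ne_zero_iff.1 (by rw [hw1]; exact one_ne_zero)
  let γ : ℝ → sphere (0 : ℂ) 1 := fun θ => ⟨w * Complex.exp (θ * Complex.I), by
    rw [mem_sphere_zero_iff_norm, norm_mul, hw1, Complex.norm_exp_ofReal_mul_I, one_mul]⟩
  have hγ : Continuous γ := by fun_prop
  let φ : ℝ → ℂ := fun θ => e.symm (γ θ)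
  have hφ : Continuous φ := by fun_prop
  have hφx : ∀ θ, φ θ = x ↔ Complex.exp (θ * Complex.I) = 1 := fun θ => by
    have : φ θ = x ↔ γ θ = w := by
      rw [hw, ← e.symm_apply_eq, Subtype.ext_iff]
    rw [this, Subtype.ext_iff]
    exact mul_eq_left₀ hw0
  obtain ⟨δ, hδ, hball⟩ := Metric.continuousAt_iff.1 (hφ.continuousAt (x := 0)) r hr
  rw [(hφx 0).2 (by simp)] at hball
  set η := min δ Real.pi
  have hη : 0 < η := lt_min hδ Real.pi_pos
  refine ⟨φ '' Icc η (2 * Real.pi - η), ?_, isCompact_Icc.image hφ,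
    isPreconnected_Icc.image _ hφ.continuousOn, ?_, ?_⟩
  · rintro _ ⟨θ, -, rfl⟩
    exact (e.symm (γ θ)).2
  · rintro ⟨θ, ⟨h1, h2⟩, h3⟩
    rw [hφx, Complex.exp_eq_one_iff] at h3
    obtain ⟨n, hn⟩ := h3
    have hn : θ = n * (2 * Real.pi) := by
      have := congrArg Complex.im hn
      simpa using this
    have h0 : (0 : ℝ) < n := by
      by_contra! h0
      nlinarith [Real.pi_pos]
    have h1 : (n : ℝ) < 1 := by
      by_contra! h0
      nlinarith [Real.pi_pos]
    norm_cast at h0 h1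
    omega
  · rintro q ⟨hq, hqr⟩
    set v : sphere (0 : ℂ) 1 := e ⟨q, hq⟩ with hv
    have hv1 : ‖(v : ℂ)‖ = 1 := mem_sphere_zero_iff_norm.1 v.2
    set θ := Complex.arg (v / w) with hθ
    have hexp : Complex.exp (θ * Complex.I) = v / w := by
      have := Complex.norm_mul_exp_arg_mul_I ((v : ℂ) / w)
      rwa [norm_div, hv1, hw1, div_one, Complex.ofReal_one, one_mul] at this
    have hφq : ∀ t : ℝ, Complex.exp (t * Complex.I) = v / w → φ t = q := fun t ht => by
      have : γ t = v := Subtype.ext (by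
        change (w : ℂ) * Complex.exp (t * Complex.I) = v
        rw [ht, mul_div_cancel₀ _ hw0])
      simp only [φ, this, hv, e.symm_apply_apply]
    have hδθ : δ ≤ |θ| := by
      by_contra! hlt
      refine hqr (mem_ball.2 ?_)
      rw [← hφq θ hexp]
      exact hball (by simpa using hlt)
    have hηδ : η ≤ δ := min_le_left _ _
    have hηπ : η ≤ Real.pi := min_le_right _ _
    have h1 := Complex.neg_pi_lt_arg ((v : ℂ) / w)
    have h2 := Complex.arg_le_pi ((v : ℂ) / w)
    rcases le_abs'.1 hδθ with h | h
    · refine ⟨θ + 2 * Real.pi, ⟨by linarith, by linarith⟩, hφq _ ?_⟩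
      push_cast
      rw [add_mul, Complex.exp_add, Complex.exp_two_pi_mul_I, mul_one, hexp]
    · exact ⟨θ, ⟨by linarith, by linarith⟩, hφq _ hexp⟩

/-- The only logarithm of `1` of norm less than `1` is `0`. -/
theorem Complex.eq_zero_of_exp_eq_one_of_norm_lt_one {w : ℂ} (h : Complex.exp w = 1)
    (hw : ‖w‖ < 1) : w = 0 := by
  obtain ⟨n, rfl⟩ := Complex.exp_eq_one_iff.1 h
  have hn : |(n : ℝ)| < 1 := by
    simp only [norm_mul, Complex.norm_intCast, Complex.norm_ofNat, Complex.norm_real,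
      Real.norm_eq_abs, abs_of_pos Real.pi_pos, Complex.norm_I] at hw
    nlinarith [Real.pi_gt_three, abs_nonneg (n : ℝ)]
  norm_cast at hn
  simp [Int.abs_lt_one_iff.1 hn]

/-- Two points of an open connected set `D` close to `x` can be joined in `D ∩ ball x r`, provided
the part outside `ball x r` of each component of the boundary can be joined outside `ball x s`
within this component. -/
theorem mem_connectedComponentIn_inter_ball {D : Set ℂ} (hDo : IsOpen D) (hD : IsPreconnected D)
    (hK : IsCompact (frontier D)) {x : ℂ} {r s : ℝ} (hs : 0 < s) (hsr : s ≤ r)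
    (hA : ∀ y ∈ frontier D, ∃ A ⊆ frontier D, IsPreconnected A ∧ Disjoint A (ball x s) ∧
      connectedComponentIn (frontier D) y \ ball x r ⊆ A)
    {a b : ℂ} (ha : a ∈ D ∩ ball x (s / 3)) (hb : b ∈ D ∩ ball x (s / 3)) :
    b ∈ connectedComponentIn (D ∩ ball x r) a := by
  classical
  set K := frontier D with hKdef
  have hDK : Disjoint D K := by
    rw [hKdef, hDo.frontier_eq]
    exact disjoint_sdiff_right
  obtain ⟨f, hf, hfexp⟩ := exists_log_sub_div_sub_of_isPreconnected hDo hD hDK ha.1 hb.1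
  obtain ⟨hL, hLexp⟩ := continuousOn_log_sub_div_sub (S := (ball x s)ᶜ) (a := a) (b := b)
    fun z hz => by
      have h1 := mem_ball.1 ha.2
      have h2 := mem_ball.1 hb.2
      rw [mem_compl_iff, mem_ball, not_lt] at hz
      have h3 := dist_triangle_right a b x
      have h4 := dist_triangle z b x
      linarith
  set L : ℂ → ℂ := fun z => Complex.log ((z - a) / (z - b))
  have hrs : (ball x r)ᶜ ⊆ (ball x s)ᶜ := compl_subset_compl.2 (ball_subset_ball hsr)
  have hsub : ∀ z ∈ K, z ∉ ball x s → Complex.exp (f z - L z) = 1 := fun z hz hzs => by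
    rw [Complex.exp_sub, hfexp z hz, hLexp z hzs, ← hfexp z hz, div_self (Complex.exp_ne_zero _)]
  have hconst : ∀ y ∈ K, ∃ c, Complex.exp c = 1 ∧
      ∀ z ∈ connectedComponentIn K y, z ∉ ball x r → f z - L z = c := by
    intro y hy
    obtain ⟨A, hAK, hAc, hAs, hAr⟩ := hA y hy
    rcases A.eq_empty_or_nonempty with rfl | ⟨w, hw⟩
    · exact ⟨0, Complex.exp_zero, fun z hz hzr => (hAr ⟨hz, hzr⟩).elim⟩
    · have hAs' : A ⊆ (ball x s)ᶜ := hAs.subset_compl_right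
      refine ⟨f w - L w, hsub w (hAK hw) (hAs' hw), fun z hz hzr => ?_⟩
      refine hAc.sub_eq_sub_of_exp_eq_s7 (hf.mono hAK) (hL.mono hAs') (fun t ht => ?_)
        (hAr ⟨hz, hzr⟩) hw
      rw [hfexp t (hAK ht)]
      exact (hLexp t (hAs' ht)).symm
  have : CompactSpace K := isCompact_iff_compactSpace.1 hK
  obtain ⟨F, hF, hFP⟩ := exists_continuous_of_forall_exists_isClopen (X := K) (Y := ℂ)
    (P := fun z w => Complex.exp w = (z - a) / (z - b) ∧ ((z : ℂ) ∉ ball x r → w = L z)) (by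
      rintro ⟨y, hy⟩
      obtain ⟨c, hc, hcc⟩ := hconst y hy
      have hclosed : IsClosed {z : K | (z : ℂ) ∉ ball x r ∧ 1 ≤ ‖f z - L z - c‖} := by
        have h1 : IsClosed {z : K | (z : ℂ) ∉ ball x r} :=
          (isOpen_ball.isClosed_compl).preimage continuous_subtype_val
        have h2 : ContinuousOn (fun z : K => ‖f z - L z - c‖) {z : K | (z : ℂ) ∉ ball x r} := by
          refine ((ContinuousOn.sub ?_ ?_).sub continuousOn_const).norm
          · exact hf.comp continuous_subtype_val.continuousOn fun z _ => z.2
          · exact hL.comp continuous_subtype_val.continuousOn fun z hz => hrs hz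
        exact h2.preimage_isClosed_of_isClosed h1 isClosed_Ici
      obtain ⟨N, hN, hyN, hNV⟩ := exists_isClopen_of_connectedComponent_subset
        (x := (⟨y, hy⟩ : K)) hclosed.isOpen_compl (by
          rintro z hz ⟨hzr, hz1⟩
          have : (z : ℂ) ∈ connectedComponentIn K y := by
            rw [connectedComponentIn_eq_image hy]
            exact mem_image_of_mem _ hz
          rw [hcc z this hzr, sub_self, norm_zero] at hz1
          exact hz1.not_gt one_pos)
      refine ⟨N, hN, hyN, fun z => f z - c, ?_, fun z hz => ⟨?_, fun hzr => ?_⟩⟩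
      · exact ((continuousOn_iff_continuous_domRestrict.1 hf).sub continuous_const).continuousOn
      · rw [Complex.exp_sub, hc, div_one, hfexp z z.2]
      · have hlt : ‖f z - L z - c‖ < 1 := by
          by_contra! h
          exact hNV hz ⟨hzr, h⟩
        have := Complex.eq_zero_of_exp_eq_one_of_norm_lt_one (by
          rw [Complex.exp_sub, hc, div_one, hsub z z.2 (hrs hzr)]) hlt
        linear_combination this)
  obtain ⟨g, hg⟩ := ContinuousMap.exists_restrict_eq hK.isClosed ⟨F, hF⟩
  have hg : ∀ z : K, g z = F z := fun z => DFunLike.congr_fun hg z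
  set X := K ∪ (ball x r)ᶜ with hX
  have hXcl : IsClosed X := hK.isClosed.union isOpen_ball.isClosed_compl
  have hXc : Xᶜ = Kᶜ ∩ ball x r := by rw [hX, compl_union, compl_compl]
  have hballs : ball x (s / 3) ⊆ ball x r := ball_subset_ball (by linarith)
  have hmem : ∀ c ∈ D ∩ ball x (s / 3), c ∈ Xᶜ := fun c hc => by
    rw [hXc]
    exact ⟨hDK.notMem_of_mem_left hc.1, hballs hc.2⟩
  have hUsub : connectedComponentIn Xᶜ a ⊆ Kᶜ ∩ ball x r :=
    hXc ▸ connectedComponentIn_subset _ _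
  have hh1 : EqOn (fun z => if z ∈ ball x r then g z else L z) g K := fun z hz => by
    by_cases hzr : z ∈ ball x r
    · exact if_pos hzr
    · exact (if_neg hzr).trans (((hg ⟨z, hz⟩).trans ((hFP ⟨z, hz⟩).2 hzr)).symm)
  have hh2 : EqOn (fun z => if z ∈ ball x r then g z else L z) L (ball x r)ᶜ :=
    fun z hz => if_neg hz
  have hbU := mem_connectedComponentIn_of_exists_log hXcl (hmem a ha) (hmem b hb)
    (isBounded_ball.subset (hUsub.trans inter_subset_right))
    (h := fun z => if z ∈ ball x r then g z else L z)
    ((g.continuous.continuousOn.congr hh1).union_of_isClosed ((hL.mono hrs).congr hh2)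
      hK.isClosed isOpen_ball.isClosed_compl) (by
      rintro z (hz | hz)
      · refine (congrArg Complex.exp ((hh1 hz).trans (hg ⟨z, hz⟩))).trans ?_
        exact (hFP ⟨z, hz⟩).1
      · exact (congrArg Complex.exp (hh2 hz)).trans (hLexp z (hrs hz)))
  have hUpre : IsPreconnected (connectedComponentIn Xᶜ a) := isPreconnected_connectedComponentIn
  have haU : a ∈ connectedComponentIn Xᶜ a := mem_connectedComponentIn (hmem a ha)
  have hUD : connectedComponentIn Xᶜ a ⊆ D := by
    refine hUpre.subset_of_closure_inter_subset hDo ⟨a, haU, ha.1⟩ fun z hz => ?_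
    by_contra hzD
    exact (hUsub hz.2).1 (hDo.frontier_eq.symm.subset ⟨hz.1, hzD⟩)
  exact hUpre.subset_connectedComponentIn haU (subset_inter hUD (hUsub.trans inter_subset_right))
    hbU

/-- Each point of the boundary of a generalized Jordan domain has arbitrarily small disks in whose
complement every boundary component is connected up to a part inside a given larger disk. -/
theorem IsGeneralizedJordanDomain.exists_isPreconnected_disjoint_ball {D : Set ℂ}
    (hD : IsGeneralizedJordanDomain D) {x : ℂ} (hx : x ∈ frontier D) {r : ℝ} (hr : 0 < r) :
    ∃ s, 0 < s ∧ s ≤ r ∧ ∀ y ∈ frontier D, ∃ A ⊆ frontier D, IsPreconnected A ∧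
      Disjoint A (ball x s) ∧ connectedComponentIn (frontier D) y \ ball x r ⊆ A := by
  obtain ⟨-, -, ⟨hK, -, hfin⟩, hcomp⟩ := hD
  set K := frontier D
  obtain ⟨A, hAQ, hAc, hA, hxA, hQA⟩ : ∃ A ⊆ connectedComponentIn K x, IsCompact A ∧
      IsPreconnected A ∧ x ∉ A ∧ connectedComponentIn K x \ ball x r ⊆ A := by
    rcases hcomp x hx with h | h
    · refine ⟨∅, empty_subset _, isCompact_empty, isPreconnected_empty, notMem_empty x, ?_⟩
      rw [h]
      rintro _ ⟨rfl, hz⟩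
      exact hz (mem_ball_self hr)
    · exact h.exists_isPreconnected_notMem (mem_connectedComponentIn hx) hr
  have hBfin : {Q : Set ℂ | ((∃ y ∈ K, Q = connectedComponentIn K y) ∧ r / 2 < diam Q) ∧
      x ∉ Q}.Finite := (hfin (r / 2) (half_pos hr)).subset fun Q hQ => hQ.1
  have hBclosed : IsClosed (A ∪ ⋃₀ {Q : Set ℂ | ((∃ y ∈ K, Q = connectedComponentIn K y) ∧
      r / 2 < diam Q) ∧ x ∉ Q}) := by
    rw [sUnion_eq_biUnion]
    refine hAc.isClosed.union (hBfin.isClosed_biUnion ?_)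
    rintro _ ⟨⟨⟨y, hy, rfl⟩, -⟩, -⟩
    rw [connectedComponentIn_eq_image hy]
    exact hK.isClosed.isClosedEmbedding_subtypeVal.isClosedMap _ isClosed_connectedComponent
  obtain ⟨s, hs, hsB⟩ := Metric.isOpen_iff.1 hBclosed.isOpen_compl x (by
    rintro (h | ⟨Q, hQ, hxQ⟩)
    · exact hxA h
    · exact hQ.2 hxQ)
  refine ⟨min s (r / 2), lt_min hs (half_pos hr), (min_le_right _ _).trans (half_le_self hr.le),
    fun y hy => ?_⟩
  have hss : ball x (min s (r / 2)) ⊆ ball x s := ball_subset_ball (min_le_left _ _)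
  by_cases hxy : x ∈ connectedComponentIn K y
  · rw [connectedComponentIn_eq hxy]
    exact ⟨A, hAQ.trans (connectedComponentIn_subset _ _), hA,
      disjoint_left.2 fun z hz hzs => hsB (hss hzs) (Or.inl hz), hQA⟩
  by_cases hdisj : Disjoint (connectedComponentIn K y) (ball x (min s (r / 2)))
  · exact ⟨_, connectedComponentIn_subset _ _, isPreconnected_connectedComponentIn, hdisj,
      sdiff_subset⟩
  · obtain ⟨z, hz, hzs⟩ := not_disjoint_iff.1 hdisj
    refine ⟨∅, empty_subset _, isPreconnected_empty, empty_disjoint _, ?_⟩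
    rintro w ⟨hw, hwr⟩
    have hdiam : diam (connectedComponentIn K y) ≤ r / 2 := by
      by_contra! hlt
      exact hsB (hss hzs) (Or.inr ⟨_, ⟨⟨⟨y, hy, rfl⟩, hlt⟩, hxy⟩, hz⟩)
    have h1 := dist_le_diam_of_mem (hK.isBounded.subset (connectedComponentIn_subset K y)) hw hz
    have h2 : dist z x < r / 2 := (mem_ball.1 hzs).trans_le (min_le_right _ _)
    exact (hwr (mem_ball.2 (by linarith [dist_triangle w z x]))).elim

/-- Every generalized Jordan domain is simply connected at the boundary. -/
theorem stmt_7 (D : Set ℂ) (hD : IsGeneralizedJordanDomain D) :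
    ∀ x ∈ frontier D, ∀ r > (0:ℝ), ∃ U : Set ℂ,
      IsOpen U ∧ x ∈ U ∧ U ⊆ Metric.ball x r ∧ IsConnected (U ∩ D) := by
  intro x hx r hr
  obtain ⟨s, hs, hsr, hA⟩ := hD.exists_isPreconnected_disjoint_ball hx hr
  obtain ⟨⟨-, hDo, hDc⟩, -, ⟨hK, -⟩, -⟩ := hD
  have hs3 : 0 < s / 3 := by positivity
  have hsub : ball x (s / 3) ⊆ ball x r := ball_subset_ball (by linarith)
  obtain ⟨a, has, haD⟩ := mem_closure_iff.1 (frontier_subset_closure hx) _ isOpen_ball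
    (mem_ball_self hs3)
  have hVsub : connectedComponentIn (D ∩ ball x r) a ⊆ D ∩ ball x r :=
    connectedComponentIn_subset _ _
  refine ⟨ball x (s / 3) ∪ connectedComponentIn (D ∩ ball x r) a,
    isOpen_ball.union (hDo.inter isOpen_ball).connectedComponentIn, Or.inl (mem_ball_self hs3),
    union_subset hsub (hVsub.trans inter_subset_right), ?_⟩
  have : (ball x (s / 3) ∪ connectedComponentIn (D ∩ ball x r) a) ∩ D =
      connectedComponentIn (D ∩ ball x r) a := by
    refine Subset.antisymm ?_ fun z hz => ⟨Or.inr hz, (hVsub hz).1⟩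
    rintro z ⟨hz | hz, hzD⟩
    · exact mem_connectedComponentIn_inter_ball hDo hDc.isPreconnected hK hs hsr hA ⟨haD, has⟩
        ⟨hzD, hz⟩
    · exact hz
  rw [this]
  exact isConnected_connectedComponentIn_iff.2 ⟨haD, hsub has⟩
end
end
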